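/- arXiv:2104.06971 — 3 statements merged into one kernel-verified Lean document; each statement's English description precedes it below -/
import Mathlib

section
/- For every integer r ≥ 3 and every ε > 0, there exists a constant c = c(r, ε) > 0 such that the following holds: if G is a finite simple graph on n ≥ 1 vertices with average degree d = 2e(G)/n, and the number of copies of K_r in G (i.e., r-element sets of pairwise adjacent vertices) is at most (1−ε) · (n^r / r!) · (d/n)^(r(r−1)/2), then the surplus of G is at least c · d^(r−1) / n^(r−3). -/
namespace MaxCutPaper

variable {V : Type*}

/-- The size of the cut induced by a vertex subset `S`: the number of edges of `G`
with one endpoint in `S` and the other outside `S` (counted via ordered pairs with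
first coordinate in `S`). -/
noncomputable def cutSize [Fintype V] (G : SimpleGraph V) (S : Finset V) : ℕ :=
  Nat.card {p : V × V // p.1 ∈ S ∧ p.2 ∉ S ∧ G.Adj p.1 p.2}

/-- The maximum size of a cut of `G`. -/
noncomputable def maxCut [Fintype V] (G : SimpleGraph V) : ℕ :=
  (Finset.univ : Finset V).powerset.sup (cutSize G)

/-- The number of edges of `G`. -/
noncomputable def edgeCount (G : SimpleGraph V) : ℕ := Nat.card G.edgeSet

/-- The surplus of `G`: `mc(G) - e(G)/2`. -/
noncomputable def surplus [Fintype V] (G : SimpleGraph V) : ℝ :=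
  (maxCut G : ℝ) - (edgeCount G : ℝ) / 2

/-- The degree of a vertex. -/
noncomputable def degC (G : SimpleGraph V) (v : V) : ℕ := Nat.card (G.neighborSet v)

/-- The number of copies of `K_r` in `G`, i.e. `r`-element sets of pairwise adjacent
vertices. -/
noncomputable def cliqueCount (G : SimpleGraph V) (r : ℕ) : ℕ :=
  Nat.card {s : Finset V // G.IsNClique r s}

/-- `G` contains no cycle of length `r`. -/
def CycleFree (G : SimpleGraph V) (r : ℕ) : Prop :=
  ∀ ⦃v : V⦄ (w : G.Walk v v), w.IsCycle → w.length ≠ r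

/-- `G` is `d`-degenerate (for a real `d ≥ 0`): every (induced) subgraph has a vertex of
degree at most `d`. -/
def Degenerate (G : SimpleGraph V) (d : ℝ) : Prop :=
  ∀ B : Finset V, B.Nonempty → ∃ v ∈ B, (Nat.card {u : V // u ∈ B ∧ G.Adj v u} : ℝ) ≤ d

/-- The number of edges of `G` with both endpoints in `T`. -/
noncomputable def edgesIn (G : SimpleGraph V) (T : Finset V) : ℝ :=
  (Nat.card {p : V × V // p.1 ∈ T ∧ p.2 ∈ T ∧ G.Adj p.1 p.2} : ℝ) / 2

/-- The bilinear form `∑ f(x) A(x,y) g(y)` of a kernel `A`. -/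
noncomputable def bilin {V : Type*} [Fintype V] (A : V → V → ℝ) (f g : V → ℝ) : ℝ :=
  ∑ x, ∑ y, f x * A x y * g y

theorem sum_bool_prod {ι R : Type*} [Fintype ι] [DecidableEq ι] [CommSemiring R]
    (F : ι → Bool → R) :
    ∑ e : ι → Bool, ∏ t, F t (e t) = ∏ t, (F t true + F t false) := by
  have h := Finset.prod_univ_sum (fun _ : ι => (Finset.univ : Finset Bool)) F
  rw [Fintype.piFinset_univ] at h
  rw [← h]
  exact Finset.prod_congr rfl fun t _ => by simp

theorem abs_prod_one_add_sub_le {ι : Type*} (s : Finset ι) (σ : ι → ℝ) :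
    |∏ t ∈ s, (1 + σ t) - 1 - ∑ t ∈ s, σ t| ≤
      Real.exp (∑ t ∈ s, |σ t|) - 1 - ∑ t ∈ s, |σ t| := by
  classical
  induction s using Finset.induction_on with
  | empty => simp
  | insert a s ha ih =>
    rw [Finset.prod_insert ha, Finset.sum_insert ha, Finset.sum_insert ha]
    set P := ∏ t ∈ s, (1 + σ t)
    set Q := ∑ t ∈ s, σ t
    set B := ∑ t ∈ s, |σ t|
    have hB : 0 ≤ B := Finset.sum_nonneg fun _ _ => abs_nonneg _
    have hQ : |Q| ≤ B := Finset.abs_sum_le_sum_abs _ _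
    have h1 : |P - 1| ≤ Real.exp B - 1 := by
      have : P - 1 = (P - 1 - Q) + Q := by ring
      rw [this]
      refine (abs_add_le _ _).trans ?_
      linarith
    have h2 : (1 + σ a) * P - 1 - (σ a + Q) = (P - 1 - Q) + σ a * (P - 1) := by ring
    rw [h2]
    refine (abs_add_le _ _).trans ?_
    rw [abs_mul, Real.exp_add]
    have h3 : |σ a| * |P - 1| ≤ |σ a| * (Real.exp B - 1) :=
      mul_le_mul_of_nonneg_left h1 (abs_nonneg _)
    have h4 : |σ a| + 1 ≤ Real.exp |σ a| := Real.add_one_le_exp _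
    have h5 : 1 ≤ Real.exp B := Real.one_le_exp hB
    nlinarith

/-- The sign attached to a Boolean. -/
def boolSign (b : Bool) : ℝ := if b then 1 else -1

/-- A bounded odd function of random signs, whose correlations are nearly inner products. -/
noncomputable def signRound {ι : Type*} [Fintype ι] (a : ι → ℝ) (e : ι → Bool) : ℝ :=
  (∏ t, (1 + Complex.I * (boolSign (e t) * a t : ℝ))).im

theorem sum_signRound_mul {ι : Type*} [Fintype ι] [DecidableEq ι] (a b : ι → ℝ) :
    ∑ e : ι → Bool, signRound a e * signRound b e =
      2 ^ Fintype.card ι * ((∏ t, (1 + a t * b t) - ∏ t, (1 - a t * b t)) / 2) := by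
  have key : ∀ z w : ℂ, z.im * w.im = ((z * (starRingEnd ℂ) w).re - (z * w).re) / 2 := by
    intro z w
    simp only [Complex.mul_re, Complex.conj_re, Complex.conj_im]
    ring
  have hI : Complex.I ^ 2 = -1 := Complex.I_sq
  have h1 : ∑ e : ι → Bool, (∏ t, (1 + Complex.I * (boolSign (e t) * a t : ℝ))) *
      (starRingEnd ℂ) (∏ t, (1 + Complex.I * (boolSign (e t) * b t : ℝ))) =
      ((2 ^ Fintype.card ι * ∏ t, (1 + a t * b t) : ℝ) : ℂ) := by
    simp only [map_prod, ← Finset.prod_mul_distrib]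
    rw [sum_bool_prod (fun t s => (1 + Complex.I * (boolSign s * a t : ℝ)) *
      (starRingEnd ℂ) (1 + Complex.I * (boolSign s * b t : ℝ)))]
    push_cast
    rw [← Finset.card_univ, ← Finset.prod_const, ← Finset.prod_mul_distrib]
    refine Finset.prod_congr rfl fun t _ => ?_
    simp [boolSign]
    linear_combination (-2 * (a t : ℂ) * b t) * hI
  have h2 : ∑ e : ι → Bool, (∏ t, (1 + Complex.I * (boolSign (e t) * a t : ℝ))) *
      (∏ t, (1 + Complex.I * (boolSign (e t) * b t : ℝ))) =
      ((2 ^ Fintype.card ι * ∏ t, (1 - a t * b t) : ℝ) : ℂ) := by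
    simp only [← Finset.prod_mul_distrib]
    rw [sum_bool_prod (fun t s => (1 + Complex.I * (boolSign s * a t : ℝ)) *
      (1 + Complex.I * (boolSign s * b t : ℝ)))]
    push_cast
    rw [← Finset.card_univ, ← Finset.prod_const, ← Finset.prod_mul_distrib]
    refine Finset.prod_congr rfl fun t _ => ?_
    simp [boolSign]
    linear_combination (2 * (a t : ℂ) * b t) * hI
  unfold signRound
  simp only [key, ← Finset.sum_div, Finset.sum_sub_distrib, ← Complex.re_sum]
  rw [h1, h2, Complex.ofReal_re, Complex.ofReal_re]
  ring

theorem abs_signRound_le {ι : Type*} [Fintype ι] (a : ι → ℝ) (ha : ∑ t, a t ^ 2 ≤ 1)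
    (e : ι → Bool) : |signRound a e| ≤ 2 := by
  refine (Complex.abs_im_le_norm _).trans ?_
  refine abs_le_of_sq_le_sq' (b := 2) ?_ (by norm_num) |>.2
  rw [norm_prod, ← Finset.prod_pow]
  calc ∏ t, ‖(1 + Complex.I * (boolSign (e t) * a t : ℝ))‖ ^ 2
      = ∏ t, (1 + a t ^ 2) := by
        refine Finset.prod_congr rfl fun t _ => ?_
        rw [Complex.sq_norm, Complex.normSq_apply]
        cases e t <;> simp [boolSign] <;> ring
    _ ≤ ∏ t, Real.exp (a t ^ 2) := by
        refine Finset.prod_le_prod (fun t _ => by positivity) fun t _ => ?_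
        have := Real.add_one_le_exp (a t ^ 2)
        linarith
    _ = Real.exp (∑ t, a t ^ 2) := (Real.exp_sum _ _).symm
    _ ≤ Real.exp 1 := Real.exp_le_exp.2 ha
    _ ≤ 2 ^ 2 := by have := Real.exp_one_lt_d9; linarith

theorem half_prod_sub_prod_le {ι : Type*} [Fintype ι] (σ : ι → ℝ) (h : ∑ t, |σ t| ≤ 1) :
    (∏ t, (1 + σ t) - ∏ t, (1 - σ t)) / 2 ≤ ∑ t, σ t + (∑ t, |σ t|) ^ 2 := by
  have h0 : 0 ≤ ∑ t, |σ t| := Finset.sum_nonneg fun _ _ => abs_nonneg _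
  have h1 := abs_prod_one_add_sub_le Finset.univ σ
  have h2 := abs_prod_one_add_sub_le Finset.univ (fun t => -σ t)
  simp only [abs_neg, Finset.sum_neg_distrib, ← sub_eq_add_neg] at h2
  have h3 := Real.abs_exp_sub_one_sub_id_le (x := ∑ t, |σ t|) (by rwa [abs_of_nonneg h0])
  have h4 := (abs_le.1 h3).2
  have h5 := (abs_le.1 h1).2
  have h6 := (abs_le.1 h2).1
  linarith

/-- Rounding a normalised family of vectors to bounded functions. -/
theorem neg_le_sum_bilin_of_normalized {V : Type*} [Fintype V] {A : V → V → ℝ}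
    (hA : ∀ x y, 0 ≤ A x y) {S : ℝ}
    (hS : ∀ f : V → ℝ, (∀ x, |f x| ≤ 1) → -S ≤ bilin A f f)
    {ι : Type*} [Fintype ι] (s : ι → V → ℝ) {η : ℝ} (hη : η ≤ 1)
    (hs : ∀ x, ∑ t, s t x ^ 2 ≤ η) :
    -(4 * S) ≤ ∑ t, bilin A (s t) (s t) + η * ∑ t, bilin A (fun x => |s t x|) fun x => |s t x| := by
  classical
  have hround : ∀ e : ι → Bool,
      -(4 * S) ≤ bilin A (fun x => signRound (fun t => s t x) e)
        (fun x => signRound (fun t => s t x) e) := by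
    intro e
    have := hS (fun x => signRound (fun t => s t x) e / 2) (fun x => by
      rw [abs_div, abs_two, div_le_one two_pos]
      exact abs_signRound_le _ ((hs x).trans hη) e)
    have h2 : bilin A (fun x => signRound (fun t => s t x) e / 2)
        (fun x => signRound (fun t => s t x) e / 2) =
        bilin A (fun x => signRound (fun t => s t x) e)
        (fun x => signRound (fun t => s t x) e) / 4 := by
      simp only [bilin, Finset.sum_div]
      exact Finset.sum_congr rfl fun x _ => Finset.sum_congr rfl fun y _ => by ring
    linarith
  have hcs : ∀ x y, ∑ t, |s t x * s t y| ≤ η := by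
    intro x y
    calc ∑ t, |s t x * s t y| ≤ ∑ t, (s t x ^ 2 + s t y ^ 2) / 2 := by
          refine Finset.sum_le_sum fun t _ => abs_le.2 ⟨?_, ?_⟩
          · nlinarith [sq_nonneg (s t x + s t y)]
          · nlinarith [sq_nonneg (s t x - s t y)]
      _ ≤ η := by
          rw [← Finset.sum_div, Finset.sum_add_distrib]
          linarith [hs x, hs y]
  have hpt : ∀ x y, (∏ t, (1 + s t x * s t y) - ∏ t, (1 - s t x * s t y)) / 2 ≤
      ∑ t, s t x * s t y + η * ∑ t, |s t x| * |s t y| := by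
    intro x y
    refine (half_prod_sub_prod_le _ ((hcs x y).trans hη)).trans ?_
    simp only [← abs_mul]
    have h0 : 0 ≤ ∑ t, |s t x * s t y| := Finset.sum_nonneg fun _ _ => abs_nonneg _
    nlinarith [hcs x y]
  have hsum : ∑ e : ι → Bool, bilin A (fun x => signRound (fun t => s t x) e)
        (fun x => signRound (fun t => s t x) e) =
      2 ^ Fintype.card ι * ∑ x, ∑ y, A x y *
        ((∏ t, (1 + s t x * s t y) - ∏ t, (1 - s t x * s t y)) / 2) := by
    simp only [bilin]
    rw [Finset.sum_comm, Finset.mul_sum]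
    refine Finset.sum_congr rfl fun x _ => ?_
    rw [Finset.sum_comm, Finset.mul_sum]
    refine Finset.sum_congr rfl fun y _ => ?_
    have := sum_signRound_mul (fun t => s t x) (fun t => s t y)
    rw [mul_left_comm, ← this, Finset.mul_sum]
    exact Finset.sum_congr rfl fun e _ => by ring
  have hlow : 2 ^ Fintype.card ι * -(4 * S) ≤
      ∑ e : ι → Bool, bilin A (fun x => signRound (fun t => s t x) e)
        (fun x => signRound (fun t => s t x) e) := by
    have := Finset.sum_le_sum fun e (_ : e ∈ (Finset.univ : Finset (ι → Bool))) => hround e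
    simpa using this
  rw [hsum] at hlow
  have hlow' := le_of_mul_le_mul_left hlow (by positivity)
  refine hlow'.trans ?_
  have hexp : ∑ t, bilin A (s t) (s t) +
      η * ∑ t, bilin A (fun x => |s t x|) (fun x => |s t x|) =
      ∑ x, ∑ y, A x y * (∑ t, s t x * s t y + η * ∑ t, |s t x| * |s t y|) := by
    simp only [bilin]
    rw [Finset.sum_comm, Finset.sum_comm (s := Finset.univ (α := ι)), Finset.mul_sum,
      ← Finset.sum_add_distrib]
    refine Finset.sum_congr rfl fun x _ => ?_
    rw [Finset.sum_comm, Finset.sum_comm (s := Finset.univ (α := ι)), Finset.mul_sum,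
      ← Finset.sum_add_distrib]
    refine Finset.sum_congr rfl fun y _ => ?_
    simp only [mul_add, Finset.mul_sum]
    congr 1 <;> exact Finset.sum_congr rfl fun t _ => by ring
  rw [hexp]
  exact Finset.sum_le_sum fun x _ => Finset.sum_le_sum fun y _ =>
    mul_le_mul_of_nonneg_left (hpt x y) (hA x y)

theorem bilin_mono {V : Type*} [Fintype V] {A : V → V → ℝ} (hA : ∀ x y, 0 ≤ A x y)
    {f g f' g' : V → ℝ} (hf : ∀ x, 0 ≤ f x) (hg : ∀ x, 0 ≤ g x) (hff : ∀ x, f x ≤ f' x)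
    (hgg : ∀ x, g x ≤ g' x) : bilin A f g ≤ bilin A f' g' :=
  Finset.sum_le_sum fun x _ => Finset.sum_le_sum fun y _ =>
    mul_le_mul (mul_le_mul_of_nonneg_right (hff x) (hA x y)) (hgg y) (hg y)
      (mul_nonneg ((hf x).trans (hff x)) (hA x y))

theorem bilin_smul_smul {V : Type*} [Fintype V] (A : V → V → ℝ) (c : ℝ) (f g : V → ℝ) :
    bilin A (fun x => c * f x) (fun x => c * g x) = c ^ 2 * bilin A f g := by
  simp only [bilin, Finset.mul_sum]
  exact Finset.sum_congr rfl fun x _ => Finset.sum_congr rfl fun y _ => by ring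

/-- The rounding lemma: quadratic forms that are bounded below on bounded functions are
bounded below on weighted families of vectors, up to a small relative error. -/
theorem sum_bilin_ge {V : Type*} [Fintype V] {A : V → V → ℝ}
    (hA : ∀ x y, 0 ≤ A x y) {S : ℝ}
    (hS : ∀ f : V → ℝ, (∀ x, |f x| ≤ 1) → -S ≤ bilin A f f)
    {ι : Type*} [Fintype ι] (ω : ι → ℝ) (hω : ∀ t, 0 ≤ ω t) (h H : ι → V → ℝ)
    (hH : ∀ t x, |h t x| ≤ H t x) {D : ℝ} (hD : 0 < D) (hcol : ∀ x, ∑ t, ω t * H t x ^ 2 ≤ D)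
    {η : ℝ} (hη0 : 0 < η) (hη : η ≤ 1) :
    -(4 * S * D / η) - η * ∑ t, ω t * bilin A (H t) (H t) ≤ ∑ t, ω t * bilin A (h t) (h t) := by
  have hr : ∀ t, √(η * ω t / D) ^ 2 = η * ω t / D := fun t =>
    Real.sq_sqrt (div_nonneg (mul_nonneg hη0.le (hω t)) hD.le)
  have key := neg_le_sum_bilin_of_normalized hA hS (fun t x => √(η * ω t / D) * h t x) hη (by
    intro x
    calc ∑ t, (√(η * ω t / D) * h t x) ^ 2 ≤ ∑ t, η / D * (ω t * H t x ^ 2) := by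
          refine Finset.sum_le_sum fun t _ => ?_
          rw [mul_pow, hr]
          have : h t x ^ 2 ≤ H t x ^ 2 := sq_le_sq' (abs_le.1 (hH t x)).1 (abs_le.1 (hH t x)).2
          have h2 : 0 ≤ η * ω t / D := div_nonneg (mul_nonneg hη0.le (hω t)) hD.le
          calc η * ω t / D * h t x ^ 2 ≤ η * ω t / D * H t x ^ 2 :=
                mul_le_mul_of_nonneg_left this h2
            _ = _ := by ring
      _ ≤ η / D * D := by
          rw [← Finset.mul_sum]
          exact mul_le_mul_of_nonneg_left (hcol x) (by positivity)
      _ = η := by field_simp)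
  have e1 : ∑ t, bilin A (fun x => √(η * ω t / D) * h t x) (fun x => √(η * ω t / D) * h t x) =
      η / D * ∑ t, ω t * bilin A (h t) (h t) := by
    rw [Finset.mul_sum]
    refine Finset.sum_congr rfl fun t _ => ?_
    rw [bilin_smul_smul, hr]
    ring
  have e2 : ∑ t, bilin A (fun x => |√(η * ω t / D) * h t x|)
      (fun x => |√(η * ω t / D) * h t x|) ≤ η / D * ∑ t, ω t * bilin A (H t) (H t) := by
    rw [Finset.mul_sum]
    refine Finset.sum_le_sum fun t _ => ?_
    simp only [abs_mul, abs_of_nonneg (Real.sqrt_nonneg _)]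
    rw [bilin_smul_smul, hr]
    have h2 : 0 ≤ η * ω t / D := div_nonneg (mul_nonneg hη0.le (hω t)) hD.le
    have := bilin_mono hA (fun x => abs_nonneg (h t x)) (fun x => abs_nonneg (h t x)) (hH t) (hH t)
    calc _ ≤ η * ω t / D * bilin A (H t) (H t) := mul_le_mul_of_nonneg_left this h2
      _ = _ := by ring
  rw [e1] at key
  have k2 := key.trans (add_le_add_right (mul_le_mul_of_nonneg_left e2 hη0.le) _)
  have k3 := mul_le_mul_of_nonneg_left k2 (by positivity : 0 ≤ D / η)
  have k4 : D / η * -(4 * S) = -(4 * S * D / η) := by ring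
  have k5 : D / η * (η / D * ∑ t, ω t * bilin A (h t) (h t) +
      η * (η / D * ∑ t, ω t * bilin A (H t) (H t))) =
      ∑ t, ω t * bilin A (h t) (h t) + η * ∑ t, ω t * bilin A (H t) (H t) := by
    field_simp
  rw [k4, k5] at k3
  linarith

theorem div_cube_ge {θ y : ℝ} (hθ : 0 ≤ θ) (hθ1 : θ ≤ 1) (hy : 0 < y) :
    1 + (3 - θ) * (y - 1) ≤ y ^ 3 / (1 - θ + θ * y) := by
  have hpos : 0 < 1 - θ + θ * y := by
    rcases hθ1.eq_or_lt with h | h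
    · rw [h]; linarith
    · have := mul_nonneg hθ hy.le
      linarith
  rw [le_div_iff₀ hpos]
  have h : 0 ≤ (y - 1) ^ 2 * (3 - θ * (3 - θ) + (y - 1)) := by
    apply mul_nonneg (sq_nonneg _)
    nlinarith [mul_nonneg (sub_nonneg.2 hθ1) (by linarith : 0 ≤ 2 - θ)]
  nlinarith [h]

theorem parameter_inequality_of_mem_Icc {c C ε δ θ y : ℝ} (hθ : 0 ≤ θ) (hθ1 : θ ≤ 1) (hC1 : 1 ≤ C)
    (hc : c = C * (3 - θ) - (C - 1)) (hδ0 : 0 < δ) (hδ1 : δ ≤ 1) (hδ : δ * (C * 200000) ≤ ε)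
    (hy : 1 / 2 ≤ y) (hy2 : y ≤ 40) {φ : ℝ} (hφ : φ ≤ 1 - θ + θ * (y + δ)) :
    c * y - (c - 1) - ε ≤ C * ((1 - δ) * (2 * (y / (1 - θ + θ * y)) * (2 * y * y - y ^ 2)) -
      (y / (1 - θ + θ * y)) ^ 2 * y * φ) - (C - 1 + δ) * (y + δ) := by
  have hpos : 0 < 1 - θ + θ * y := by nlinarith
  set a := y / (1 - θ + θ * y) with ha
  have ha0 : 0 ≤ a := by positivity
  have ha40 : a ≤ 40 := by
    rw [ha, div_le_iff₀ hpos]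
    nlinarith
  have hal : a * (1 - θ + θ * y) = y := div_mul_cancel₀ _ hpos.ne'
  have hmain := div_cube_ge hθ hθ1 (by linarith : 0 < y)
  have hcube : y ^ 3 / (1 - θ + θ * y) = a * y ^ 2 := by rw [ha]; ring
  rw [hcube] at hmain
  have h1 : a ^ 2 * y * φ ≤ a ^ 2 * y * (1 - θ + θ * (y + δ)) :=
    mul_le_mul_of_nonneg_left hφ (by positivity)
  have h2 : a ^ 2 * y * (1 - θ + θ * (y + δ)) = a * y ^ 2 + a ^ 2 * y * θ * δ := by
    linear_combination a * y * hal
  have hay : a * y ^ 2 ≤ 40 * 40 ^ 2 := by gcongr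
  have hay2 : a ^ 2 * y * θ ≤ 40 ^ 2 * 40 * 1 := by gcongr
  have h3 : a ^ 2 * y * θ * δ ≤ 40 ^ 2 * 40 * δ := by nlinarith
  have h4 : a * y ^ 2 * δ ≤ 40 * 40 ^ 2 * δ := by nlinarith
  have h5 : a * y ^ 2 - 192000 * δ ≤
      (1 - δ) * (2 * a * (2 * y * y - y ^ 2)) - a ^ 2 * y * φ := by nlinarith
  have h6 : C * (a * y ^ 2 - 192000 * δ) ≤
      C * ((1 - δ) * (2 * a * (2 * y * y - y ^ 2)) - a ^ 2 * y * φ) :=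
    mul_le_mul_of_nonneg_left h5 (by linarith)
  have h7 : C * (1 + (3 - θ) * (y - 1)) ≤ C * (a * y ^ 2) :=
    mul_le_mul_of_nonneg_left hmain (by linarith)
  have h8 : (C - 1 + δ) * (y + δ) ≤ (C - 1) * y + 42 * C * δ := by
    nlinarith [mul_le_mul_of_nonneg_right hC1 hδ0.le, mul_nonneg hδ0.le (sub_nonneg.2 hδ1)]
  have h9 : C * δ * 42 ≤ C * δ * 8000 := by
    have : 0 ≤ C * δ := by positivity
    linarith
  rw [hc]
  nlinarith

theorem exists_parameters (c C ε θ : ℝ) (hθ : 0 ≤ θ) (hθ1 : θ ≤ 1) (hC1 : 1 ≤ C)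
    (hc3 : 3 ≤ c) (hcC : c ≤ 3 * C)
    (hc : c = C * (3 - θ) - (C - 1)) (hε : 0 < ε) :
    ∃ δ : ℝ, 0 < δ ∧ δ ≤ 1 ∧ ∀ y : ℝ, 0 ≤ y → ∃ g a : ℝ, 1 / 2 ≤ g ∧ g ≤ 40 ∧ 0 ≤ a ∧ a ≤ 40 ∧
      ∀ φ : ℝ, φ ≤ 1 - θ + θ * (y + δ) → φ ≤ 4 * g →
        c * y - (c - 1) - ε ≤ C * ((1 - δ) * (2 * a * (2 * g * y - g ^ 2)) - a ^ 2 * y * φ) -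
          (C - 1 + δ) * (y + δ) := by
  have hCpos : 0 < C := by linarith
  refine ⟨min (1 / 8) (min (1 / (8 * C)) (ε / (C * 200000))), by positivity,
    (min_le_left _ _).trans (by norm_num), ?_⟩
  set δ := min (1 / 8) (min (1 / (8 * C)) (ε / (C * 200000))) with hδ
  have hδ0 : 0 < δ := by positivity
  have hδ1 : δ ≤ 1 / 8 := min_le_left _ _
  have hδ2 : δ * (8 * C) ≤ 1 := by
    rw [← le_div_iff₀ (by positivity)]
    exact (min_le_right _ _).trans (min_le_left _ _)
  have hδ3 : δ * (C * 200000) ≤ ε := by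
    rw [← le_div_iff₀ (by positivity)]
    exact (min_le_right _ _).trans (min_le_right _ _)
  intro y hy
  rcases lt_or_ge y (1 / 2) with h | h
  · refine ⟨1, 0, by norm_num, by norm_num, le_rfl, by norm_num, fun φ _ _ => ?_⟩
    have h1 : (C - 1 + δ) * (y + δ) ≤ (C - 1) * y + δ * C + δ := by nlinarith
    have h2 : (c + C - 1) * y ≤ (c + C - 1) * (1 / 2) := by
      apply mul_le_mul_of_nonneg_left h.le; linarith
    nlinarith
  rcases le_or_gt y 40 with h' | h'
  · have hpos : 0 < 1 - θ + θ * y := by nlinarith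
    refine ⟨y, y / (1 - θ + θ * y), h, h', by positivity, ?_, fun φ hφ _ =>
      parameter_inequality_of_mem_Icc hθ hθ1 hC1 hc hδ0 (by linarith) hδ3 h h' hφ⟩
    rw [div_le_iff₀ hpos]
    nlinarith
  · refine ⟨40, 1 / 4, by norm_num, by norm_num, by norm_num, by norm_num, fun φ _ hφ => ?_⟩
    have h1 : (1 / 4 : ℝ) ^ 2 * y * φ ≤ (1 / 4 : ℝ) ^ 2 * y * (4 * 40) :=
      mul_le_mul_of_nonneg_left hφ (by positivity)
    have h2 : (7 / 8) * (2 * (1 / 4) * (2 * 40 * y - 40 ^ 2)) ≤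
        (1 - δ) * (2 * (1 / 4) * (2 * 40 * y - 40 ^ 2)) :=
      mul_le_mul_of_nonneg_right (by linarith) (by nlinarith)
    have h3 : (C - 1 + δ) * (y + δ) ≤ C * y + C := by nlinarith
    have h4 : C * (5 * y) ≤
        C * ((1 - δ) * (2 * (1 / 4) * (2 * 40 * y - 40 ^ 2)) - (1 / 4) ^ 2 * y * φ) :=
      mul_le_mul_of_nonneg_left (by nlinarith) hCpos.le
    nlinarith

/-- The weighted count of ordered `k`-cliques of the kernel `A`, with vertex weights `u`. -/
noncomputable def cliqueSum {V : Type*} [Fintype V] (A : V → V → ℝ) : ℕ → (V → ℝ) → ℝ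
  | 0, _ => 1
  | k + 1, u => ∑ x, u x * cliqueSum A k fun y => u y * A x y

theorem cliqueSum_nonneg {V : Type*} [Fintype V] {A : V → V → ℝ} (hA : ∀ x y, 0 ≤ A x y) (k : ℕ) :
    ∀ u : V → ℝ, (∀ x, 0 ≤ u x) → 0 ≤ cliqueSum A k u := by
  induction k with
  | zero => intro u _; simp [cliqueSum]
  | succ k ih =>
    intro u hu
    exact Finset.sum_nonneg fun x _ => mul_nonneg (hu x) (ih _ fun y => mul_nonneg (hu y) (hA x y))

theorem cliqueSum_mono {V : Type*} [Fintype V] {A : V → V → ℝ} (hA : ∀ x y, 0 ≤ A x y) (k : ℕ) :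
    ∀ u u' : V → ℝ, (∀ x, 0 ≤ u x) → (∀ x, u x ≤ u' x) → cliqueSum A k u ≤ cliqueSum A k u' := by
  induction k with
  | zero => intro u u' _ _; simp [cliqueSum]
  | succ k ih =>
    intro u u' hu huu
    refine Finset.sum_le_sum fun x _ => mul_le_mul (huu x) (ih _ _ (fun y => ?_) fun y => ?_)
      (cliqueSum_nonneg hA k _ fun y => mul_nonneg (hu y) (hA x y)) ((hu x).trans (huu x))
    · exact mul_nonneg (hu y) (hA x y)
    · exact mul_le_mul_of_nonneg_right (huu y) (hA x y)

theorem cliqueSum_two {V : Type*} [Fintype V] (A : V → V → ℝ) (u : V → ℝ) :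
    cliqueSum A 2 u = bilin A u u := by
  simp only [cliqueSum, bilin, mul_one, Finset.mul_sum]
  exact Finset.sum_congr rfl fun x _ => Finset.sum_congr rfl fun y _ => by ring

theorem bilin_eq_sum_right {V : Type*} [Fintype V] (A : V → V → ℝ) (f g : V → ℝ) :
    bilin A f g = ∑ x, f x * ∑ y, A x y * g y := by
  simp only [bilin, Finset.mul_sum, mul_assoc]

theorem bilin_comm {V : Type*} [Fintype V] {A : V → V → ℝ} (hA : ∀ x y, A x y = A y x)
    (f g : V → ℝ) : bilin A f g = bilin A g f := by
  simp only [bilin]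
  rw [Finset.sum_comm]
  exact Finset.sum_congr rfl fun x _ => Finset.sum_congr rfl fun y _ => by rw [hA y x]; ring

theorem bilin_add_smul_self {V : Type*} [Fintype V] {A : V → V → ℝ} (hA : ∀ x y, A x y = A y x)
    (f g : V → ℝ) (c : ℝ) : bilin A (fun x => f x + c * g x) (fun x => f x + c * g x) =
      bilin A f f + 2 * c * bilin A f g + c ^ 2 * bilin A g g := by
  have h : 2 * c * bilin A f g = c * bilin A f g + c * bilin A g f := by
    rw [bilin_comm hA g f]; ring
  rw [h]
  simp only [bilin, Finset.mul_sum, ← Finset.sum_add_distrib]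
  exact Finset.sum_congr rfl fun x _ => Finset.sum_congr rfl fun y _ => by ring

/-- Lower bound for the diagonal terms `bilin A v v` in terms of the mixed terms `bilin A v u`. -/
theorem sum_mul_bilin_self_ge {V : Type*} [Fintype V] {A : V → V → ℝ}
    (hA : ∀ x y, 0 ≤ A x y) (hsymm : ∀ x y, A x y = A y x) {S : ℝ}
    (hS : ∀ f : V → ℝ, (∀ x, |f x| ≤ 1) → -S ≤ bilin A f f)
    {ι : Type*} [Fintype ι] (ω : ι → ℝ) (hω : ∀ t, 0 ≤ ω t) (α : ι → ℝ) (hα : ∀ t, 0 ≤ α t)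
    (u v : ι → V → ℝ) (hu : ∀ t x, 0 ≤ u t x) (hv : ∀ t x, 0 ≤ v t x) {D : ℝ} (hD : 0 < D)
    (hcol : ∀ x, ∑ t, ω t * (v t x + α t * u t x) ^ 2 ≤ D) {δ : ℝ} (hδ0 : 0 < δ) (hδ : δ ≤ 1) :
    ∑ t, ω t * ((1 - δ) * (2 * α t * bilin A (v t) (u t)) - α t ^ 2 * bilin A (u t) (u t)) -
      8 * S * D / δ ≤ ∑ t, ω t * bilin A (v t) (v t) := by
  have hS0 : 0 ≤ S := by
    have := hS 0 (by simp)
    simpa [bilin] using this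
  have key := sum_bilin_ge hA hS ω hω (fun t x => v t x + -α t * u t x)
    (fun t x => v t x + α t * u t x) (fun t x => by
      have h1 := mul_nonneg (hα t) (hu t x)
      have h2 := hv t x
      rw [abs_le]
      constructor <;> linarith) hD hcol (half_pos hδ0) (by linarith : δ / 2 ≤ 1)
  simp only [bilin_add_smul_self hsymm] at key
  set P := ∑ t, ω t * (2 * α t * bilin A (v t) (u t)) with hP
  set E := ∑ t, ω t * (α t ^ 2 * bilin A (u t) (u t)) with hE
  set T := ∑ t, ω t * bilin A (v t) (v t) with hT
  have e1 : ∑ t, ω t * (bilin A (v t) (v t) + 2 * α t * bilin A (v t) (u t) +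
      α t ^ 2 * bilin A (u t) (u t)) = T + P + E := by
    simp only [hP, hE, hT, ← Finset.sum_add_distrib]
    exact Finset.sum_congr rfl fun t _ => by ring
  have e2 : ∑ t, ω t * (bilin A (v t) (v t) + 2 * -α t * bilin A (v t) (u t) +
      (-α t) ^ 2 * bilin A (u t) (u t)) = T - P + E := by
    simp only [hP, hE, hT, ← Finset.sum_add_distrib, ← Finset.sum_sub_distrib]
    exact Finset.sum_congr rfl fun t _ => by ring
  have e3 : ∑ t, ω t * ((1 - δ) * (2 * α t * bilin A (v t) (u t)) -
      α t ^ 2 * bilin A (u t) (u t)) = (1 - δ) * P - E := by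
    simp only [hP, hE, Finset.mul_sum, ← Finset.sum_sub_distrib]
    exact Finset.sum_congr rfl fun t _ => by ring
  rw [e1, e2] at key
  rw [e3]
  have hP0 : 0 ≤ P := Finset.sum_nonneg fun t _ => mul_nonneg (hω t) <|
    mul_nonneg (mul_nonneg zero_le_two (hα t)) <| Finset.sum_nonneg fun x _ =>
      Finset.sum_nonneg fun y _ => mul_nonneg (mul_nonneg (hv t x) (hA x y)) (hu t y)
  have e4 : 4 * S * D / (δ / 2) = 8 * S * D / δ := by field_simp; ring
  rw [e4] at key
  have hX : 0 ≤ 8 * S * D / δ := by positivity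
  have h1 : (1 + δ / 2) * ((1 - δ) * P - E - 8 * S * D / δ) ≤ (1 + δ / 2) * T := by
    nlinarith [mul_nonneg hδ0.le hX, mul_nonneg (mul_nonneg hδ0.le hδ0.le) hP0]
  exact le_of_mul_le_mul_left h1 (by linarith)

/-- A damping of the kernel that makes all weighted degrees bounded by `4 * g * q`. -/
theorem exists_truncation {V : Type*} [Fintype V] {A : V → V → ℝ}
    (hA : ∀ x y, 0 ≤ A x y) (hsymm : ∀ x y, A x y = A y x) (u : V → ℝ) (hu : ∀ x, 0 ≤ u x)
    {q g : ℝ} (hq : 0 < q) (hg : 0 < g) :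
    ∃ v : V → V → ℝ, (∀ x z, 0 ≤ v x z) ∧ (∀ x z, v x z ≤ u z * A x z) ∧
      (∀ x, ∑ z, v x z ≤ 4 * g * q) ∧ (∀ z, ∑ x, u x * v x z ≤ 4 * g * q * u z) ∧
      2 * g * q * bilin A u u - g ^ 2 * q ^ 2 * ∑ x, u x ≤ ∑ x, u x * bilin A (v x) u := by
  set d : V → ℝ := fun x => (∑ z, A x z * u z) / q with hd
  have hdq : ∀ x, ∑ z, A x z * u z = q * d x := fun x => by
    rw [hd]; field_simp
  have hd0 : ∀ x, 0 ≤ d x := fun x =>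
    div_nonneg (Finset.sum_nonneg fun z _ => mul_nonneg (hA x z) (hu z)) hq.le
  set κ : V → V → ℝ := fun x z => 4 * g / max (4 * g) (max (d x) (d z)) with hκ
  have hmax : ∀ x z, 0 < max (4 * g) (max (d x) (d z)) := fun x z =>
    lt_max_of_lt_left (by linarith)
  have hκ0 : ∀ x z, 0 ≤ κ x z := fun x z => div_nonneg (by linarith) (hmax x z).le
  have hκ1 : ∀ x z, κ x z ≤ 1 := fun x z => (div_le_one (hmax x z)).2 (le_max_left _ _)
  have hκs : ∀ x z, κ x z = κ z x := fun x z => by simp only [hκ, max_comm (d x)]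
  have hκd : ∀ x z, κ x z * d x ≤ 4 * g := fun x z => by
    simp only [hκ]
    rw [div_mul_eq_mul_div, div_le_iff₀ (hmax x z)]
    exact mul_le_mul_of_nonneg_left ((le_max_left _ _).trans (le_max_right _ _)) (by linarith)
  have hκmin : ∀ x z, min (d x) (2 * g) + min (d z) (2 * g) ≤ κ x z * (d x + d z) := fun x z => by
    simp only [hκ]
    rw [div_mul_eq_mul_div, le_div_iff₀ (hmax x z)]
    have h1 := min_le_left (d x) (2 * g)
    have h2 := min_le_right (d x) (2 * g)
    have h3 := min_le_left (d z) (2 * g)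
    have h4 := min_le_right (d z) (2 * g)
    have h5 : 0 ≤ min (d x) (2 * g) := le_min (hd0 x) (by linarith)
    have h6 : 0 ≤ min (d z) (2 * g) := le_min (hd0 z) (by linarith)
    rcases max_cases (4 * g) (max (d x) (d z)) with h | h
    · rw [h.1]; nlinarith
    · rw [h.1]
      rcases max_cases (d x) (d z) with h' | h'
      · rw [h'.1]; nlinarith [hd0 x, hd0 z]
      · rw [h'.1]; nlinarith [hd0 x, hd0 z]
  have hrow : ∀ x, ∑ z, κ x z * A x z * u z ≤ 4 * g * q := by
    intro x
    have hdx := hdq x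
    rcases (hd0 x).eq_or_lt with h0 | h0
    · calc ∑ z, κ x z * A x z * u z ≤ ∑ z, A x z * u z := by
            refine Finset.sum_le_sum fun z _ => ?_
            rw [mul_assoc]
            exact mul_le_of_le_one_left (mul_nonneg (hA x z) (hu z)) (hκ1 x z)
        _ ≤ 4 * g * q := by rw [hdx, ← h0]; nlinarith
    · refine le_of_mul_le_mul_left ?_ h0
      calc d x * ∑ z, κ x z * A x z * u z = ∑ z, κ x z * d x * (A x z * u z) := by
            rw [Finset.mul_sum]; exact Finset.sum_congr rfl fun z _ => by ring
        _ ≤ ∑ z, 4 * g * (A x z * u z) := Finset.sum_le_sum fun z _ =>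
            mul_le_mul_of_nonneg_right (hκd x z) (mul_nonneg (hA x z) (hu z))
        _ = d x * (4 * g * q) := by rw [← Finset.mul_sum, hdx]; ring
  refine ⟨fun x z => κ x z * A x z * u z, fun x z => mul_nonneg (mul_nonneg (hκ0 x z) (hA x z))
    (hu z), fun x z => ?_, hrow, fun z => ?_, ?_⟩
  · have := mul_le_of_le_one_left (mul_nonneg (hA x z) (hu z)) (hκ1 x z)
    linarith
  · calc ∑ x, u x * (κ x z * A x z * u z) = (∑ x, κ z x * A z x * u x) * u z := by
          rw [Finset.sum_mul]
          exact Finset.sum_congr rfl fun x _ => by rw [hκs x z, hsymm x z]; ring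
      _ ≤ _ := mul_le_mul_of_nonneg_right (hrow z) (hu z)
  · have e1 : ∑ x, u x * bilin A (fun z => κ x z * A x z * u z) u =
        q * ∑ x, ∑ z, u x * u z * A x z * (κ x z * d z) := by
      rw [Finset.mul_sum]
      refine Finset.sum_congr rfl fun x _ => ?_
      rw [bilin_eq_sum_right, Finset.mul_sum, Finset.mul_sum]
      refine Finset.sum_congr rfl fun z _ => ?_
      rw [hdq z]; ring
    have e2 : ∑ x, ∑ z, u x * u z * A x z * (κ x z * d z) =
        ∑ x, ∑ z, u x * u z * A x z * (κ x z * d x) := by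
      rw [Finset.sum_comm]
      exact Finset.sum_congr rfl fun x _ => Finset.sum_congr rfl fun z _ => by
        rw [hκs x z, hsymm x z]; ring
    have e3 : ∑ x, ∑ z, u x * u z * A x z * min (d z) (2 * g) =
        ∑ x, ∑ z, u x * u z * A x z * min (d x) (2 * g) := by
      rw [Finset.sum_comm]
      exact Finset.sum_congr rfl fun x _ => Finset.sum_congr rfl fun z _ => by
        rw [hsymm x z]; ring
    have e4 : ∑ x, ∑ z, u x * u z * A x z * min (d x) (2 * g) =
        q * ∑ x, u x * (d x * min (d x) (2 * g)) := by
      rw [Finset.mul_sum]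
      refine Finset.sum_congr rfl fun x _ => ?_
      have := hdq x
      calc _ = u x * min (d x) (2 * g) * ∑ z, A x z * u z := by
            rw [Finset.mul_sum]; exact Finset.sum_congr rfl fun z _ => by ring
        _ = _ := by rw [this]; ring
    have h1 : ∑ x, ∑ z, u x * u z * A x z * (min (d x) (2 * g) + min (d z) (2 * g)) ≤
        ∑ x, ∑ z, u x * u z * A x z * (κ x z * (d x + d z)) :=
      Finset.sum_le_sum fun x _ => Finset.sum_le_sum fun z _ =>
        mul_le_mul_of_nonneg_left (hκmin x z) (mul_nonneg (mul_nonneg (hu x) (hu z)) (hA x z))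
    simp only [mul_add, Finset.sum_add_distrib] at h1
    rw [e3, ← e2] at h1
    have h2 : ∑ x, ∑ z, u x * u z * A x z * min (d x) (2 * g) ≤
        ∑ x, ∑ z, u x * u z * A x z * (κ x z * d z) := by linarith
    rw [e4] at h2
    have h3 : ∑ x, u x * (2 * g * d x - g ^ 2) ≤ ∑ x, u x * (d x * min (d x) (2 * g)) := by
      refine Finset.sum_le_sum fun x _ => mul_le_mul_of_nonneg_left ?_ (hu x)
      rcases min_cases (d x) (2 * g) with h | h
      · rw [h.1]; nlinarith [sq_nonneg (d x - g)]
      · rw [h.1]; nlinarith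
    have e5 : q ^ 2 * ∑ x, u x * (2 * g * d x - g ^ 2) =
        2 * g * q * bilin A u u - g ^ 2 * q ^ 2 * ∑ x, u x := by
      rw [bilin_eq_sum_right]
      simp only [hdq]
      simp only [Finset.mul_sum, ← Finset.sum_sub_distrib]
      exact Finset.sum_congr rfl fun x _ => by ring
    rw [e1, ← e5]
    calc q ^ 2 * ∑ x, u x * (2 * g * d x - g ^ 2)
        ≤ q ^ 2 * ∑ x, u x * (d x * min (d x) (2 * g)) :=
          mul_le_mul_of_nonneg_left h3 (by positivity)
      _ = q * (q * ∑ x, u x * (d x * min (d x) (2 * g))) := by ring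
      _ ≤ _ := mul_le_mul_of_nonneg_left h2 hq.le

theorem exists_root {l : ℕ} {ξ δ : ℝ} (hδ0 : 0 < δ) (hδ1 : δ ≤ 1) (hξ : δ ≤ ξ) :
    ∃ ζ : ℝ, δ ≤ ζ ∧ ζ ^ (l + 2) = ξ ∧
      ζ ^ l ≤ 1 - (l : ℝ) / (l + 2) + (l : ℝ) / (l + 2) * ξ := by
  have hξ0 : 0 < ξ := hδ0.trans_le hξ
  have hpow : (ξ ^ (((l + 2 : ℕ) : ℝ)⁻¹)) ^ (l + 2) = ξ :=
    Real.rpow_inv_natCast_pow hξ0.le (by omega)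
  refine ⟨ξ ^ (((l + 2 : ℕ) : ℝ)⁻¹), ?_, hpow, ?_⟩
  · refine le_of_pow_le_pow_left₀ (n := l + 2) (by omega) (by positivity) ?_
    rw [hpow]
    exact (pow_le_of_le_one hδ0.le hδ1 (by omega)).trans hξ
  · rw [← Real.rpow_natCast, ← Real.rpow_mul hξ0.le]
    have h := rpow_one_add_le_one_add_mul_self (s := ξ - 1) (p := (l : ℝ) / (l + 2))
      (by linarith) (by positivity) (by rw [div_le_one (by positivity)]; linarith)
    rw [add_sub_cancel] at h
    have e : ((l + 2 : ℕ) : ℝ)⁻¹ * l = l / (l + 2) := by push_cast; field_simp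
    rw [e]
    linarith

theorem choose_two_succ_real (l : ℕ) :
    (((l + 1).choose 2 : ℕ) : ℝ) = ((l + 1) * l : ℝ) / 2 := by
  rw [Nat.cast_choose_two]; push_cast; ring

theorem exists_local_data (l : ℕ) {ε : ℝ} (hε : 0 < ε) :
    ∃ δ : ℝ, 0 < δ ∧ δ ≤ 1 ∧ ∀ (V : Type) [Fintype V] (A : V → V → ℝ) (u : V → ℝ) (m p : ℝ),
      (∀ x y, 0 ≤ A x y) → (∀ x y, A x y = A y x) → (∀ x, 0 ≤ u x) → 0 < m → 0 < p →
      ∑ x, u x ≤ m → ∃ (v : V → V → ℝ) (ζ : V → ℝ) (a : ℝ), 0 ≤ a ∧ a ≤ 40 ∧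
        (∀ x z, 0 ≤ v x z) ∧ (∀ x z, v x z ≤ u z * A x z) ∧ (∀ x, δ ≤ ζ x) ∧
        (∀ x, ζ x ^ l ≤ 160) ∧ (∀ x, ∑ z, v x z ≤ ζ x ^ (l + 2) * (p * m)) ∧
        (∀ z, ∑ x, u x * v x z ≤ 160 * (p * m) * u z) ∧
        m ^ 3 * p ^ 3 * ((l + 3).choose 2 * (bilin A u u / (p * m ^ 2)) -
          ((l + 3).choose 2 - 1) - ε) ≤
        (l + 2).choose 2 * ((1 - δ) * (2 * a * p * ∑ x, u x * bilin A (v x) u) -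
          a ^ 2 * p ^ 2 * bilin A u u * ∑ x, u x * ζ x ^ l) -
        ((l + 2).choose 2 - 1 + δ) * (m ^ 2 * p ^ 3) * ∑ x, u x * ζ x ^ (l + 2) := by
  have hC : (((l + 2).choose 2 : ℕ) : ℝ) = (l + 2) * (l + 1) / 2 := by
    rw [choose_two_succ_real]; push_cast; ring
  have hc : (((l + 3).choose 2 : ℕ) : ℝ) = (l + 3) * (l + 2) / 2 := by
    rw [choose_two_succ_real]; push_cast; ring
  rw [hC, hc]
  have hl : (0 : ℝ) ≤ l := Nat.cast_nonneg l
  set C : ℝ := (l + 2) * (l + 1) / 2 with hCdef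
  set c : ℝ := (l + 3) * (l + 2) / 2 with hcdef
  set θ : ℝ := l / (l + 2) with hθdef
  have hθ0 : 0 ≤ θ := by positivity
  have hθ1 : θ ≤ 1 := by rw [hθdef, div_le_one (by positivity)]; linarith
  have hC1 : 1 ≤ C := by nlinarith
  obtain ⟨δ, hδ0, hδ1, hδ⟩ := exists_parameters c C ε θ hθ0 hθ1 hC1 (by nlinarith) (by nlinarith)
    (by rw [hCdef, hcdef, hθdef]; field_simp; ring) hε
  refine ⟨δ, hδ0, hδ1, ?_⟩
  intro V _ A u m p hA hsymm hu hm hp hum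
  have hE0 : 0 ≤ bilin A u u := Finset.sum_nonneg fun x _ => Finset.sum_nonneg fun y _ =>
    mul_nonneg (mul_nonneg (hu x) (hA x y)) (hu y)
  set E := bilin A u u with hE
  set y := E / (p * m ^ 2) with hy
  have hy0 : 0 ≤ y := by positivity
  have hEy : E = p * m ^ 2 * y := by rw [hy]; field_simp
  obtain ⟨g, a, hg1, hg2, ha0, ha1, hfin⟩ := hδ y hy0
  have hq : 0 < p * m := mul_pos hp hm
  have hg : 0 < g := by linarith
  obtain ⟨v, hv0, hvA, hvrow, hvcol, hP⟩ := exists_truncation hA hsymm u hu hq hg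
  set ξ : V → ℝ := fun x => max ((∑ z, v x z) / (p * m)) δ with hξ
  have hξδ : ∀ x, δ ≤ ξ x := fun x => le_max_right _ _
  choose ζ hζδ hζ hζl using fun x => exists_root (l := l) hδ0 hδ1 (hξδ x)
  have hξg : ∀ x, ξ x ≤ 4 * g := fun x =>
    max_le ((div_le_iff₀ hq).2 (hvrow x)) (by linarith)
  have hζg : ∀ x, ζ x ^ l ≤ 4 * g := fun x => by
    have h1 := hζl x
    have h2 : θ * ξ x ≤ θ * (4 * g) := mul_le_mul_of_nonneg_left (hξg x) hθ0
    nlinarith [mul_nonneg (sub_nonneg.2 hθ1) (by linarith : 0 ≤ 4 * g - 1)]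
  have hξsum : ∑ x, u x * ξ x ≤ m * (y + δ) := by
    calc ∑ x, u x * ξ x ≤ ∑ x, (u x * ((∑ z, A x z * u z) / (p * m)) + u x * δ) := by
          refine Finset.sum_le_sum fun x _ => ?_
          rw [← mul_add]
          refine mul_le_mul_of_nonneg_left (max_le ?_ ?_) (hu x)
          · have : (∑ z, v x z) / (p * m) ≤ (∑ z, A x z * u z) / (p * m) :=
              div_le_div_of_nonneg_right (Finset.sum_le_sum fun z _ => by
                rw [mul_comm]; exact hvA x z) hq.le
            linarith
          · have : 0 ≤ (∑ z, A x z * u z) / (p * m) :=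
              div_nonneg (Finset.sum_nonneg fun z _ => mul_nonneg (hA x z) (hu z)) hq.le
            linarith
      _ = E / (p * m) + (∑ x, u x) * δ := by
          rw [Finset.sum_add_distrib, ← Finset.sum_mul, hE, bilin_eq_sum_right, Finset.sum_div]
          congr 1
          exact Finset.sum_congr rfl fun x _ => (mul_div_assoc _ _ _).symm
      _ ≤ m * (y + δ) := by
          have : E / (p * m) = m * y := by rw [hEy]; field_simp
          rw [this]
          nlinarith
  have hφsum1 : ∑ x, u x * ζ x ^ l ≤ m * (1 - θ + θ * (y + δ)) := by
    calc ∑ x, u x * ζ x ^ l ≤ ∑ x, (u x * (1 - θ) + θ * (u x * ξ x)) := by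
          refine Finset.sum_le_sum fun x _ => ?_
          have := mul_le_mul_of_nonneg_left (hζl x) (hu x)
          linarith
      _ = (∑ x, u x) * (1 - θ) + θ * ∑ x, u x * ξ x := by
          rw [Finset.sum_add_distrib, ← Finset.sum_mul, Finset.mul_sum]
      _ ≤ _ := by
          have h1 := mul_le_mul_of_nonneg_right hum (sub_nonneg.2 hθ1)
          have h2 := mul_le_mul_of_nonneg_left hξsum hθ0
          linarith
  have hφsum2 : ∑ x, u x * ζ x ^ l ≤ m * (4 * g) := by
    calc ∑ x, u x * ζ x ^ l ≤ ∑ x, u x * (4 * g) :=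
          Finset.sum_le_sum fun x _ => mul_le_mul_of_nonneg_left (hζg x) (hu x)
      _ = (∑ x, u x) * (4 * g) := by rw [Finset.sum_mul]
      _ ≤ _ := mul_le_mul_of_nonneg_right hum (by linarith)
  refine ⟨v, ζ, a, ha0, ha1, hv0, hvA, hζδ, fun x => (hζg x).trans (by linarith), fun x => ?_,
    fun z => (hvcol z).trans ?_, ?_⟩
  · rw [hζ, ← div_le_iff₀ hq]
    exact le_max_left _ _
  · have := mul_le_mul_of_nonneg_right (by linarith : 4 * g ≤ 160) (mul_nonneg hq.le (hu z))
    linarith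
  · simp only [hζ]
    set Φ := ∑ x, u x * ζ x ^ l with hΦ
    set X := ∑ x, u x * bilin A (v x) u with hX
    have hX1 : p ^ 2 * m ^ 3 * (2 * g * y - g ^ 2) ≤ X := by
      refine le_trans ?_ hP
      rw [← hE, hEy]
      have : g ^ 2 * (p * m) ^ 2 * ∑ x, u x ≤ g ^ 2 * (p * m) ^ 2 * m :=
        mul_le_mul_of_nonneg_left hum (by positivity)
      linarith
    have hfin' := hfin (Φ / m) ((div_le_iff₀ hm).2 (by linarith)) ((div_le_iff₀ hm).2 (by linarith))
    have hmul := mul_le_mul_of_nonneg_left hfin' (by positivity : 0 ≤ m ^ 3 * p ^ 3)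
    refine hmul.trans ?_
    have h1 : m ^ 3 * p ^ 3 * (2 * a * (2 * g * y - g ^ 2)) ≤ 2 * a * p * X := by
      have := mul_le_mul_of_nonneg_left hX1 (by positivity : 0 ≤ 2 * a * p)
      linarith
    have h2 : m ^ 3 * p ^ 3 * (a ^ 2 * y * (Φ / m)) = a ^ 2 * p ^ 2 * E * Φ := by
      rw [hEy]; field_simp
    have h3 : (C - 1 + δ) * (m ^ 2 * p ^ 3) * ∑ x, u x * ξ x ≤
        (C - 1 + δ) * (m ^ 2 * p ^ 3) * (m * (y + δ)) :=
      mul_le_mul_of_nonneg_left hξsum (mul_nonneg (by linarith) (by positivity))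
    have h4 := mul_le_mul_of_nonneg_left h1 (sub_nonneg.2 hδ1)
    have h5 : C * ((1 - δ) * (m ^ 3 * p ^ 3 * (2 * a * (2 * g * y - g ^ 2))) -
        m ^ 3 * p ^ 3 * (a ^ 2 * y * (Φ / m))) ≤
        C * ((1 - δ) * (2 * a * p * X) - a ^ 2 * p ^ 2 * E * Φ) :=
      mul_le_mul_of_nonneg_left (by linarith) (by linarith)
    linarith

/-- Approximate lower bound for weighted sums of `(l + 2)`-clique counts, with an error that is
linear in a bound `S` for the smallest value of the quadratic form on bounded functions. -/
def CliqueBound (l : ℕ) : Prop :=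
  ∀ ε R : ℝ, 0 < ε → 0 < R → ∃ C : ℝ, 0 ≤ C ∧
    ∀ (V J : Type) [Fintype V] [Fintype J] (A : V → V → ℝ) (S D : ℝ) (w m p : J → ℝ)
      (u : J → V → ℝ), (∀ x y, 0 ≤ A x y) → (∀ x y, A x y ≤ 1) → (∀ x y, A x y = A y x) →
      (∀ f : V → ℝ, (∀ x, |f x| ≤ 1) → -S ≤ bilin A f f) → 0 < D → (∀ j, 0 ≤ w j) →
      (∀ j, 0 < m j) → (∀ j, 0 < p j) → (∀ j, p j ≤ R) → (∀ j x, 0 ≤ u j x) →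
      (∀ j x, u j x ≤ 1) → (∀ j, ∑ x, u j x ≤ m j) →
      (∀ x, ∑ j, w j * (m j ^ l * p j ^ (l + 1).choose 2 * u j x) ≤ D) →
      ∑ j, w j * (m j ^ (l + 2) * p j ^ (l + 2).choose 2 *
        ((l + 2).choose 2 * (bilin A (u j) (u j) / (p j * m j ^ 2)) -
          ((l + 2).choose 2 - 1) - ε)) - C * S * D ≤ ∑ j, w j * cliqueSum A (l + 2) (u j)

theorem cliqueBound_zero : CliqueBound 0 := by
  intro ε R hε _
  refine ⟨0, le_rfl, ?_⟩
  intro V J _ _ A S D w m p u _ _ _ _ _ hw hm hp _ _ _ _ _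
  rw [zero_mul, zero_mul, sub_zero]
  refine Finset.sum_le_sum fun j _ => mul_le_mul_of_nonneg_left ?_ (hw j)
  have hm := hm j
  have hp := hp j
  rw [zero_add, cliqueSum_two]
  have h : m j ^ 2 * p j ^ Nat.choose 2 2 * (Nat.choose 2 2 * (bilin A (u j) (u j) /
      (p j * m j ^ 2)) - (Nat.choose 2 2 - 1) - ε) =
      bilin A (u j) (u j) - m j ^ 2 * p j * ε := by
    simp only [Nat.choose_self, Nat.cast_one, pow_one]
    field_simp
    ring
  rw [h]
  have : 0 ≤ m j ^ 2 * p j * ε := by positivity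
  linarith

theorem rescaled_pow {ζ q p : ℝ} (hζ : 0 < ζ) {l k b e : ℕ} (h : (l + 2) * k = 2 * b + e) :
    (ζ ^ (l + 2) * q) ^ k * (p / ζ ^ 2) ^ b = q ^ k * p ^ b * ζ ^ e := by
  rw [mul_pow, div_pow, ← pow_mul, ← pow_mul, h, pow_add]
  field_simp

theorem rescaled_main {ζ m p T C δ : ℝ} (hζ : 0 < ζ) (hm : 0 < m) (hp : 0 < p) {l B : ℕ}
    (hB : 2 * B = (l + 1) * l) :
    (ζ ^ (l + 2) * (p * m)) ^ (l + 2) * (p / ζ ^ 2) ^ (B + l + 1) *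
      (C * (T / (p / ζ ^ 2 * (ζ ^ (l + 2) * (p * m)) ^ 2)) - (C - 1) - δ) =
    m ^ l * p ^ (B + 2 * l) * (C * (T / ζ ^ l) - (C - 1 + δ) * (m ^ 2 * p ^ 3) * ζ ^ (l + 2)) := by
  rw [rescaled_pow hζ (e := l + 2) (by nlinarith)]
  field_simp
  ring

theorem CliqueBound.succ {l : ℕ} (ih : CliqueBound l) : CliqueBound (l + 1) := by
  intro ε R hε hR
  obtain ⟨δ, hδ0, hδ1, hlocal⟩ := exists_local_data l hε
  obtain ⟨C₀, hC₀, hih⟩ := ih δ (R / δ ^ 2) hδ0 (by positivity)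
  obtain ⟨B, hB⟩ : ∃ B, B = (l + 1).choose 2 := ⟨_, rfl⟩
  have hB2 : (l + 2).choose 2 = B + l + 1 := by
    have : (l + 2).choose 2 = (l + 1).choose 1 + (l + 1).choose 2 :=
      Nat.choose_succ_succ' (l + 1) 1
    rw [Nat.choose_one_right] at this
    omega
  have hB3 : (l + 3).choose 2 = B + 2 * l + 3 := by
    have : (l + 3).choose 2 = (l + 2).choose 1 + (l + 2).choose 2 :=
      Nat.choose_succ_succ' (l + 2) 1
    rw [Nat.choose_one_right] at this
    omega
  have hBl : 2 * B = (l + 1) * l := by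
    rw [hB, Nat.choose_two_right, Nat.add_sub_cancel, Nat.mul_div_cancel']
    rw [mul_comm]
    exact (Nat.even_mul_succ_self l).two_dvd
  set C : ℝ := (((l + 2).choose 2 : ℕ) : ℝ) with hC
  have hC1 : 1 ≤ C := by rw [hC, hB2]; norm_cast; omega
  set D₂ : ℝ := 320 / δ ^ l * R ^ l + 512000 * R ^ (l + 1) with hD₂
  have hD₂0 : 0 < D₂ := by positivity
  refine ⟨C * (8 * D₂ / δ) + C₀ * 25600, by positivity, ?_⟩
  intro V J _ _ A S D w m p u hA0 hA1 hsymm hS hD hw hm hp hpR hu0 hu1 hum hcol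
  choose v ζ a ha0 ha1 hv0 hvA hζδ hζ160 hvrow hvcol hloc using fun j =>
    hlocal V A (u j) (m j) (p j) hA0 hsymm (hu0 j) (hm j) (hp j) (hum j)
  have hζ0 : ∀ j x, 0 < ζ j x := fun j x => hδ0.trans_le (hζδ j x)
  have hpow : ∀ j x, ζ j x ^ l ≠ 0 := fun j x => (pow_pos (hζ0 j x) l).ne'
  have hq : ∀ j, 0 < p j * m j := fun j => mul_pos (hp j) (hm j)
  have hvu : ∀ j x z, v j x z ≤ u j z := fun j x z =>
    (hvA j x z).trans (mul_le_of_le_one_right (hu0 j z) (hA1 x z))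
  have hv1 : ∀ j x z, v j x z ≤ 1 := fun j x z => (hvu j x z).trans (hu1 j z)
  have hcol' : ∀ x, ∑ j, w j * (m j ^ (l + 1) * p j ^ (B + l + 1) * u j x) ≤ D := by
    rw [← hB2]; exact hcol
  -- the inductive hypothesis, applied to the truncated neighbourhoods
  have hI := hih V (J × V) A S (25600 * D) (fun t => w t.1 * u t.1 t.2)
    (fun t => ζ t.1 t.2 ^ (l + 2) * (p t.1 * m t.1)) (fun t => p t.1 / ζ t.1 t.2 ^ 2)
    (fun t => v t.1 t.2) hA0 hA1 hsymm hS (by positivity)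
    (fun t => mul_nonneg (hw _) (hu0 _ _))
    (fun t => mul_pos (pow_pos (hζ0 _ _) _) (hq _))
    (fun t => div_pos (hp _) (pow_pos (hζ0 _ _) _))
    (fun t => div_le_div₀ hR.le (hpR _) (pow_pos hδ0 2) (pow_le_pow_left₀ hδ0.le (hζδ _ _) 2))
    (fun t => hv0 _ _) (fun t => hv1 _ _) (fun t => hvrow _ _) (fun z => by
      rw [Fintype.sum_prod_type, ← hB]
      calc ∑ j, ∑ x, w j * u j x * ((ζ j x ^ (l + 2) * (p j * m j)) ^ l * (p j / ζ j x ^ 2) ^ B *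
            v j x z) ≤ ∑ j, 25600 * (w j * (m j ^ (l + 1) * p j ^ (B + l + 1) * u j z)) := by
            refine Finset.sum_le_sum fun j _ => ?_
            have hW : 0 ≤ w j * ((p j * m j) ^ l * p j ^ B) :=
              mul_nonneg (hw j) (mul_nonneg (pow_nonneg (hq j).le _) (pow_nonneg (hp j).le _))
            calc _ ≤ ∑ x, w j * ((p j * m j) ^ l * p j ^ B) * 160 * (u j x * v j x z) := by
                  refine Finset.sum_le_sum fun x _ => ?_
                  rw [rescaled_pow (hζ0 j x) (e := l) (by nlinarith)]
                  have := mul_le_mul_of_nonneg_left (hζ160 j x)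
                    (mul_nonneg hW (mul_nonneg (hu0 j x) (hv0 j x z)))
                  linarith
              _ = w j * ((p j * m j) ^ l * p j ^ B) * 160 * ∑ x, u j x * v j x z := by
                  rw [Finset.mul_sum]
              _ ≤ w j * ((p j * m j) ^ l * p j ^ B) * 160 * (160 * (p j * m j) * u j z) :=
                  mul_le_mul_of_nonneg_left (hvcol j z) (by positivity)
              _ = _ := by ring
        _ ≤ 25600 * D := by
            rw [← Finset.mul_sum]
            exact mul_le_mul_of_nonneg_left (hcol' z) (by norm_num))
  -- the rounding estimate for the quadratic terms
  set W : J → ℝ := fun j => w j * (m j ^ l * p j ^ (B + 2 * l)) with hW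
  have hW0 : ∀ j, 0 ≤ W j := fun j =>
    mul_nonneg (hw j) (mul_nonneg (pow_nonneg (hm j).le _) (pow_nonneg (hp j).le _))
  have hQ := sum_mul_bilin_self_ge hA0 hsymm hS
    (fun t : J × V => W t.1 * u t.1 t.2 / ζ t.1 t.2 ^ l)
    (fun t => div_nonneg (mul_nonneg (hW0 _) (hu0 _ _)) (pow_nonneg (hζ0 _ _).le _))
    (fun t => a t.1 * ζ t.1 t.2 ^ l * p t.1)
    (fun t => mul_nonneg (mul_nonneg (ha0 _) (pow_nonneg (hζ0 _ _).le _)) (hp _).le)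
    (fun t => u t.1) (fun t => v t.1 t.2) (fun t => hu0 _) (fun t => hv0 _ _)
    (mul_pos hD₂0 hD) (fun z => by
      rw [Fintype.sum_prod_type]
      calc ∑ j, ∑ x, W j * u j x / ζ j x ^ l * (v j x z + a j * ζ j x ^ l * p j * u j z) ^ 2
          ≤ ∑ j, D₂ * (w j * (m j ^ (l + 1) * p j ^ (B + l + 1) * u j z)) := by
            refine Finset.sum_le_sum fun j _ => ?_
            have hp0 := (hp j).le
            calc _ ≤ ∑ x, (2 * W j / δ ^ l * (u j x * v j x z) +
                  u j x * (W j * 512000 * p j ^ 2 * u j z)) := by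
                  refine Finset.sum_le_sum fun x _ => ?_
                  have hφ : 0 < ζ j x ^ l := pow_pos (hζ0 j x) l
                  have hφδ : δ ^ l ≤ ζ j x ^ l := pow_le_pow_left₀ hδ0.le (hζδ j x) l
                  have h1 : (v j x z + a j * ζ j x ^ l * p j * u j z) ^ 2 ≤
                      2 * v j x z + 2 * (a j * ζ j x ^ l * p j) ^ 2 * u j z := by
                    have h2 : v j x z ^ 2 ≤ v j x z := by nlinarith [hv0 j x z, hv1 j x z]
                    have h3 : u j z ^ 2 ≤ u j z := by nlinarith [hu0 j z, hu1 j z]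
                    have h4 := mul_le_mul_of_nonneg_left h3
                      (sq_nonneg (a j * ζ j x ^ l * p j))
                    nlinarith [sq_nonneg (v j x z - a j * ζ j x ^ l * p j * u j z)]
                  have hWu : 0 ≤ W j * u j x := mul_nonneg (hW0 j) (hu0 j x)
                  calc _ ≤ W j * u j x / ζ j x ^ l *
                        (2 * v j x z + 2 * (a j * ζ j x ^ l * p j) ^ 2 * u j z) :=
                        mul_le_mul_of_nonneg_left h1 (div_nonneg hWu hφ.le)
                    _ = W j * u j x * (2 * v j x z) / ζ j x ^ l +
                        W j * u j x * (2 * (a j ^ 2 * ζ j x ^ l * p j ^ 2) * u j z) := by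
                        field_simp
                    _ ≤ W j * u j x * (2 * v j x z) / δ ^ l +
                        W j * u j x * (2 * (40 ^ 2 * 160 * p j ^ 2) * u j z) := by
                        have h5 := ha0 j
                        have h6 := ha1 j
                        have h7 := hζ160 j x
                        have h8 := hu0 j z
                        have h9 := hv0 j x z
                        gcongr
                    _ = _ := by ring
              _ = 2 * W j / δ ^ l * ∑ x, u j x * v j x z +
                  (∑ x, u j x) * (W j * 512000 * p j ^ 2 * u j z) := by
                  rw [Finset.sum_add_distrib, ← Finset.mul_sum, ← Finset.sum_mul]
              _ ≤ 2 * W j / δ ^ l * (160 * (p j * m j) * u j z) +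
                  m j * (W j * 512000 * p j ^ 2 * u j z) := by
                  have h1 := hW0 j
                  have h2 := hu0 j z
                  have h3 := hvcol j z
                  have h4 := hum j
                  gcongr
              _ = (320 / δ ^ l * p j ^ l + 512000 * p j ^ (l + 1)) *
                  (w j * (m j ^ (l + 1) * p j ^ (B + l + 1) * u j z)) := by
                  simp only [hW]
                  field_simp
                  ring
              _ ≤ _ := by
                  have h1 := hw j
                  have h2 := (hm j).le
                  have h3 := hu0 j z
                  have h4 := hpR j
                  rw [hD₂]
                  gcongr
        _ ≤ D₂ * D := by
            rw [← Finset.mul_sum]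
            exact mul_le_mul_of_nonneg_left (hcol' z) hD₂0.le) hδ0 hδ1
  set T : ℝ := ∑ t : J × V, W t.1 * u t.1 t.2 / ζ t.1 t.2 ^ l * bilin A (v t.1 t.2) (v t.1 t.2)
    with hT
  have eI : ∑ t : J × V, w t.1 * u t.1 t.2 * ((ζ t.1 t.2 ^ (l + 2) * (p t.1 * m t.1)) ^ (l + 2) *
      (p t.1 / ζ t.1 t.2 ^ 2) ^ (l + 2).choose 2 * (C * (bilin A (v t.1 t.2) (v t.1 t.2) /
        (p t.1 / ζ t.1 t.2 ^ 2 * (ζ t.1 t.2 ^ (l + 2) * (p t.1 * m t.1)) ^ 2)) - (C - 1) - δ)) =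
      C * T - ∑ j, W j * ((C - 1 + δ) * (m j ^ 2 * p j ^ 3) * ∑ x, u j x * ζ j x ^ (l + 2)) := by
    have : ∑ j, W j * ((C - 1 + δ) * (m j ^ 2 * p j ^ 3) * ∑ x, u j x * ζ j x ^ (l + 2)) =
        ∑ t : J × V, W t.1 * ((C - 1 + δ) * (m t.1 ^ 2 * p t.1 ^ 3) *
          (u t.1 t.2 * ζ t.1 t.2 ^ (l + 2))) := by
      rw [Fintype.sum_prod_type]
      simp only [Finset.mul_sum]
    rw [this, hT, Finset.mul_sum, ← Finset.sum_sub_distrib]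
    refine Finset.sum_congr rfl fun t _ => ?_
    rw [hB2, rescaled_main (hζ0 _ _) (hm _) (hp _) hBl]
    simp only [hW]
    ring
  have eQ : ∑ t : J × V, W t.1 * u t.1 t.2 / ζ t.1 t.2 ^ l *
      ((1 - δ) * (2 * (a t.1 * ζ t.1 t.2 ^ l * p t.1) * bilin A (v t.1 t.2) (u t.1)) -
        (a t.1 * ζ t.1 t.2 ^ l * p t.1) ^ 2 * bilin A (u t.1) (u t.1)) =
      ∑ j, W j * ((1 - δ) * (2 * a j * p j * ∑ x, u j x * bilin A (v j x) (u j)) -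
          a j ^ 2 * p j ^ 2 * bilin A (u j) (u j) * ∑ x, u j x * ζ j x ^ l) := by
    rw [Fintype.sum_prod_type]
    refine Finset.sum_congr rfl fun j _ => ?_
    simp only [Finset.mul_sum, ← Finset.sum_sub_distrib]
    refine Finset.sum_congr rfl fun x _ => ?_
    have := hpow j x
    field_simp
  have hK : ∑ t : J × V, w t.1 * u t.1 t.2 * cliqueSum A (l + 2) (v t.1 t.2) ≤
      ∑ j, w j * cliqueSum A (l + 1 + 2) (u j) := by
    rw [Fintype.sum_prod_type]
    refine Finset.sum_le_sum fun j _ => ?_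
    simp only [mul_assoc, ← Finset.mul_sum]
    refine mul_le_mul_of_nonneg_left ?_ (hw j)
    exact Finset.sum_le_sum fun x _ => mul_le_mul_of_nonneg_left
      (cliqueSum_mono hA0 _ _ _ (hv0 j x) (hvA j x)) (hu0 j x)
  rw [eI] at hI
  rw [eQ] at hQ
  have hCQ := mul_le_mul_of_nonneg_left hQ (by linarith : 0 ≤ C)
  have hL : ∑ j, w j * (m j ^ (l + 1 + 2) * p j ^ (l + 1 + 2).choose 2 *
        ((l + 1 + 2).choose 2 * (bilin A (u j) (u j) / (p j * m j ^ 2)) -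
          ((l + 1 + 2).choose 2 - 1) - ε)) ≤
      C * ∑ j, W j * ((1 - δ) * (2 * a j * p j * ∑ x, u j x * bilin A (v j x) (u j)) -
          a j ^ 2 * p j ^ 2 * bilin A (u j) (u j) * ∑ x, u j x * ζ j x ^ l) -
      ∑ j, W j * ((C - 1 + δ) * (m j ^ 2 * p j ^ 3) * ∑ x, u j x * ζ j x ^ (l + 2)) := by
    rw [Finset.mul_sum, ← Finset.sum_sub_distrib]
    refine Finset.sum_le_sum fun j _ => ?_
    have h := mul_le_mul_of_nonneg_left (hloc j) (hW0 j)
    refine le_trans (le_of_eq ?_) (h.trans (le_of_eq ?_))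
    · simp only [hW]
      rw [show l + 1 + 2 = l + 3 from rfl]
      nth_rewrite 1 [hB3]
      ring
    · ring
  have hfin : (C * (8 * D₂ / δ) + C₀ * 25600) * S * D =
      C * (8 * S * (D₂ * D) / δ) + C₀ * S * (25600 * D) := by ring
  rw [hfin]
  linarith

theorem cliqueBound (l : ℕ) : CliqueBound l := by
  induction l with
  | zero => exact cliqueBound_zero
  | succ l ih => exact ih.succ

/-- The zero-one adjacency kernel of a graph. -/
noncomputable def adjKernel {V : Type*} (G : SimpleGraph V) (x y : V) : ℝ :=
  open Classical in if G.Adj x y then 1 else 0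

theorem adjKernel_nonneg {V : Type*} (G : SimpleGraph V) (x y : V) : 0 ≤ adjKernel G x y := by
  unfold adjKernel; split_ifs <;> norm_num

theorem adjKernel_le_one {V : Type*} (G : SimpleGraph V) (x y : V) : adjKernel G x y ≤ 1 := by
  unfold adjKernel; split_ifs <;> norm_num

theorem adjKernel_comm {V : Type*} (G : SimpleGraph V) (x y : V) :
    adjKernel G x y = adjKernel G y x := by
  unfold adjKernel
  rw [G.adj_comm]

theorem adjKernel_self {V : Type*} (G : SimpleGraph V) (x : V) : adjKernel G x x = 0 := by
  simp [adjKernel]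

/-- A quadratic form with zero diagonal attains its minimum over the cube at a vertex. -/
theorem bilin_ge_of_signs {V : Type*} [Fintype V] {A : V → V → ℝ}
    (hsymm : ∀ x y, A x y = A y x) (hdiag : ∀ x, A x x = 0) {L : ℝ}
    (h : ∀ s : V → ℝ, (∀ x, s x = 1 ∨ s x = -1) → L ≤ bilin A s s) (f : V → ℝ)
    (hf : ∀ x, |f x| ≤ 1) : L ≤ bilin A f f := by
  classical
  suffices H : ∀ (T : Finset V) (f : V → ℝ), (∀ x, |f x| ≤ 1) →
      (∀ x, x ∉ T → f x = 1 ∨ f x = -1) → L ≤ bilin A f f from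
    H Finset.univ f hf fun x hx => absurd (Finset.mem_univ x) hx
  intro T
  induction T using Finset.induction_on with
  | empty => exact fun f _ hs => h f fun x => hs x (Finset.notMem_empty x)
  | insert a T ha ih =>
    intro f hf hs
    have key : ∀ t : ℝ, (t = 1 ∨ t = -1) →
        L ≤ bilin A f f + 2 * (t - f a) * bilin A f (Pi.single a 1) := by
      intro t ht
      have h1 := ih (fun x => f x + (t - f a) * (Pi.single a 1 : V → ℝ) x) (fun x => by
        by_cases hx : x = a
        · subst hx
          rcases ht with rfl | rfl <;> simp
        · simpa [Pi.single_eq_of_ne hx] using hf x) (fun x hx => by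
        by_cases hxa : x = a
        · subst hxa
          simpa using ht
        · simpa [Pi.single_eq_of_ne hxa] using hs x (by simp [hxa, hx]))
      rw [bilin_add_smul_self hsymm] at h1
      have h2 : bilin A (Pi.single a 1) (Pi.single a 1) = 0 := by
        simp [bilin, Pi.single_apply, hdiag]
      rw [h2] at h1
      linarith
    have hfa := abs_le.1 (hf a)
    rcases le_total 0 (bilin A f (Pi.single a 1)) with h0 | h0
    · have := key (-1) (Or.inr rfl)
      nlinarith
    · have := key 1 (Or.inl rfl)
      nlinarith

theorem sum_adjKernel {V : Type*} [Fintype V] (G : SimpleGraph V) :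
    ∑ x, ∑ y, adjKernel G x y = 2 * edgeCount G := by
  classical
  have h := G.sum_degrees_eq_twice_card_edges
  rw [edgeCount, Nat.card_eq_fintype_card, ← SimpleGraph.edgeFinset_card]
  have h' : ((∑ v, G.degree v : ℕ) : ℝ) = 2 * G.edgeFinset.card := by rw [h]; push_cast; rfl
  rw [← h', Nat.cast_sum]
  refine Finset.sum_congr rfl fun x _ => ?_
  simp [adjKernel, ← SimpleGraph.card_neighborFinset_eq_degree,
    SimpleGraph.neighborFinset_eq_filter]

theorem cutSize_eq_sum {V : Type*} [Fintype V] [DecidableEq V] (G : SimpleGraph V) (S : Finset V) :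
    (cutSize G S : ℝ) = ∑ x, ∑ y, if x ∈ S ∧ y ∉ S then adjKernel G x y else 0 := by
  classical
  rw [cutSize, Nat.card_eq_fintype_card, Fintype.card_subtype, Finset.card_filter,
    Fintype.sum_prod_type]
  push_cast
  refine Finset.sum_congr rfl fun x _ => Finset.sum_congr rfl fun y _ => ?_
  simp only [adjKernel]
  by_cases h1 : x ∈ S <;> by_cases h2 : y ∈ S <;> simp [h1, h2]

theorem neg_surplus_le_bilin {V : Type*} [Fintype V] (G : SimpleGraph V) (f : V → ℝ)
    (hf : ∀ x, |f x| ≤ 1) : -(4 * surplus G) ≤ bilin (adjKernel G) f f := by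
  classical
  refine bilin_ge_of_signs (adjKernel_comm G) (adjKernel_self G) (fun s hs => ?_) f hf
  set S : Finset V := Finset.univ.filter fun x => s x = 1 with hS
  have hcut : (cutSize G S : ℝ) ≤ maxCut G := by
    exact_mod_cast Finset.le_sup (f := cutSize G) (Finset.mem_powerset.2 (Finset.subset_univ S))
  have hswap : (cutSize G S : ℝ) = ∑ x, ∑ y, if y ∈ S ∧ x ∉ S then adjKernel G x y else 0 := by
    rw [cutSize_eq_sum, Finset.sum_comm]
    simp only [adjKernel_comm G]
  have e : bilin (adjKernel G) s s = 2 * edgeCount G - 2 * cutSize G S - 2 * cutSize G S := by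
    nth_rewrite 1 [hswap]
    rw [cutSize_eq_sum, ← sum_adjKernel]
    simp only [bilin, Finset.mul_sum, ← Finset.sum_sub_distrib]
    refine Finset.sum_congr rfl fun x _ => Finset.sum_congr rfl fun y _ => ?_
    have h1 : (-1 : ℝ) ≠ 1 := by norm_num
    rcases hs x with hx | hx <;> rcases hs y with hy | hy <;> simp [hS, hx, hy, h1] <;> ring
  rw [e, surplus]
  linarith

theorem cliqueSum_indicator_le {V : Type*} [Fintype V] [DecidableEq V] (G : SimpleGraph V)
    (k : ℕ) : ∀ U : Finset V, cliqueSum (adjKernel G) k (fun x => if x ∈ U then 1 else 0) ≤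
      k.factorial * (Nat.card {s : Finset V // G.IsNClique k s ∧ s ⊆ U} : ℝ) := by
  classical
  simp only [Nat.card_eq_fintype_card, Fintype.card_subtype]
  induction k with
  | zero =>
    intro U
    have : (Finset.univ.filter fun s : Finset V => G.IsNClique 0 s ∧ s ⊆ U) = {∅} := by
      ext s
      simp only [Finset.mem_filter, Finset.mem_univ, true_and, Finset.mem_singleton,
        SimpleGraph.isNClique_zero]
      exact ⟨fun h => h.1, fun h => ⟨h, by simp [h]⟩⟩
    rw [this]
    simp [cliqueSum]
  | succ k ih =>
    intro U
    set C : Finset (Finset V) :=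
      Finset.univ.filter fun s => G.IsNClique (k + 1) s ∧ s ⊆ U with hC
    have hlink : ∀ x ∈ U, (Finset.univ.filter fun s : Finset V =>
        G.IsNClique k s ∧ s ⊆ U.filter (G.Adj x)).card ≤ (C.filter fun t => x ∈ t).card := by
      intro x hx
      refine Finset.card_le_card_of_injOn (insert x) (fun s hs => ?_) fun s hs t ht hst => ?_
      · simp only [Finset.coe_filter, Finset.mem_univ, true_and, Set.mem_ofPred_eq] at hs
        simp only [hC, Finset.coe_filter, Finset.mem_filter, Finset.mem_univ, true_and,
          Set.mem_ofPred_eq]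
        refine ⟨⟨hs.1.insert fun b hb => (Finset.mem_filter.1 (hs.2 hb)).2, ?_⟩,
          Finset.mem_insert_self _ _⟩
        exact Finset.insert_subset hx (hs.2.trans (Finset.filter_subset _ _))
      · have hnot : ∀ s : Finset V, s ⊆ U.filter (G.Adj x) → x ∉ s := fun s hs hxs =>
          G.loopless.irrefl x (Finset.mem_filter.1 (hs hxs)).2
        simp only [Finset.coe_filter, Finset.mem_univ, true_and, Set.mem_ofPred_eq] at hs ht
        rw [← Finset.erase_insert (hnot s hs.2), hst, Finset.erase_insert (hnot t ht.2)]
    have hcount : ∑ x ∈ U, (C.filter fun t => x ∈ t).card ≤ (k + 1) * C.card := by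
      simp only [Finset.card_filter]
      rw [Finset.sum_comm, mul_comm, ← smul_eq_mul]
      refine Finset.sum_le_card_nsmul _ _ _ fun t ht => ?_
      rw [← Finset.card_filter]
      refine (Finset.card_le_card (t := t) fun x hx => (Finset.mem_filter.1 hx).2).trans ?_
      exact (Finset.mem_filter.1 ht).2.1.card_eq.le
    have hind : ∀ x, (fun y => (if y ∈ U then (1 : ℝ) else 0) * adjKernel G x y) =
        fun y => if y ∈ U.filter (G.Adj x) then 1 else 0 := by
      intro x
      funext y
      by_cases h1 : y ∈ U <;> by_cases h2 : G.Adj x y <;> simp [adjKernel, h1, h2]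
    calc cliqueSum (adjKernel G) (k + 1) (fun x => if x ∈ U then 1 else 0)
        = ∑ x ∈ U, cliqueSum (adjKernel G) k
            (fun y => if y ∈ U.filter (G.Adj x) then 1 else 0) := by
          simp only [cliqueSum, hind]
          simp
      _ ≤ ∑ x ∈ U, (k.factorial : ℝ) * (C.filter fun t => x ∈ t).card :=
          Finset.sum_le_sum fun x hx => (ih _).trans <|
            mul_le_mul_of_nonneg_left (by exact_mod_cast hlink x hx) (Nat.cast_nonneg _)
      _ = k.factorial * ((∑ x ∈ U, (C.filter fun t => x ∈ t).card : ℕ) : ℝ) := by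
          rw [← Finset.mul_sum, Nat.cast_sum]
      _ ≤ k.factorial * (((k + 1) * C.card : ℕ) : ℝ) :=
          mul_le_mul_of_nonneg_left (by exact_mod_cast hcount) (Nat.cast_nonneg _)
      _ = _ := by rw [Nat.factorial_succ]; push_cast; ring

theorem cliqueSum_one_le {V : Type*} [Fintype V] (G : SimpleGraph V) (k : ℕ) :
    cliqueSum (adjKernel G) k (fun _ => 1) ≤ k.factorial * (cliqueCount G k : ℝ) := by
  classical
  simpa [cliqueCount] using cliqueSum_indicator_le G k Finset.univ

theorem surplus_nonneg {V : Type*} [Fintype V] (G : SimpleGraph V) : 0 ≤ surplus G := by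
  have := neg_surplus_le_bilin G 0 (by simp)
  simp only [bilin, Pi.zero_apply, zero_mul, Finset.sum_const_zero] at this
  linarith

/-- For every `r ≥ 3` and `ε > 0` there is `c = c(r,ε) > 0` such that: if `G` has
`n ≥ 1` vertices, average degree `d`, and at most `(1-ε)·(n^r/r!)·(d/n)^(r(r-1)/2)`
copies of `K_r`, then `sp(G) ≥ c · d^(r-1)/n^(r-3)`. -/
theorem statement6 (r : ℕ) (hr : 3 ≤ r) (ε : ℝ) (hε : 0 < ε) :
    ∃ c : ℝ, 0 < c ∧
      ∀ (V : Type) [Fintype V] (G : SimpleGraph V) (d : ℝ),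
        1 ≤ Fintype.card V →
        d = 2 * edgeCount G / Fintype.card V →
        (cliqueCount G r : ℝ) ≤
          (1 - ε) * ((Fintype.card V : ℝ) ^ r / (r.factorial : ℝ)) *
            (d / (Fintype.card V : ℝ)) ^ (r * (r - 1) / 2) →
        surplus G ≥ c * d ^ (r - 1) / (Fintype.card V : ℝ) ^ (r - 3) := by
  obtain ⟨k, rfl⟩ : ∃ k, r = k + 3 := ⟨r - 3, by omega⟩
  obtain ⟨C, hC, hbound⟩ := cliqueBound (k + 1) (ε / 2) 1 (by positivity) one_pos
  refine ⟨ε / (8 * (C + 1)), by positivity, ?_⟩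
  intro V _ G d hn hd hcount
  have hn0 : (0 : ℝ) < Fintype.card V := by exact_mod_cast hn
  set n : ℝ := (Fintype.card V : ℝ) with hn_def
  have hsp := surplus_nonneg G
  have hdn : 2 * (edgeCount G : ℝ) = d * n := by rw [hd]; field_simp
  have hd0 : 0 ≤ d := by rw [hd]; positivity
  rw [Nat.add_sub_cancel, show k + 3 - 1 = k + 2 from rfl]
  rcases hd0.eq_or_lt with h0 | h0
  · rw [← h0]
    simpa using hsp
  have hp : 0 < d / n := div_pos h0 hn0
  have hp1 : d / n ≤ 1 := by
    rw [div_le_one hn0]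
    refine le_of_mul_le_mul_right ?_ hn0
    rw [← hdn, ← sum_adjKernel]
    calc ∑ x, ∑ y, adjKernel G x y ≤ ∑ _x : V, ∑ _y : V, (1 : ℝ) :=
          Finset.sum_le_sum fun x _ => Finset.sum_le_sum fun y _ => adjKernel_le_one G x y
      _ = n * n := by simp [hn_def]
  have hE : bilin (adjKernel G) (fun _ => 1) (fun _ => 1) = d * n := by
    rw [← hdn, ← sum_adjKernel]
    simp [bilin]
  have hD : 0 < n ^ (k + 1) * (d / n) ^ (k + 2).choose 2 := by positivity
  have key := hbound V Unit (adjKernel G) (4 * surplus G)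
    (n ^ (k + 1) * (d / n) ^ (k + 2).choose 2) (fun _ => 1) (fun _ => n) (fun _ => d / n)
    (fun _ _ => 1) (adjKernel_nonneg G) (adjKernel_le_one G) (adjKernel_comm G)
    (neg_surplus_le_bilin G) hD (fun _ => zero_le_one) (fun _ => hn0) (fun _ => hp) (fun _ => hp1)
    (fun _ _ => zero_le_one) (fun _ _ => le_rfl) (fun _ => by simp [hn_def]) (fun _ => by simp)
  simp only [Finset.univ_unique, Finset.sum_singleton, one_mul, hE] at key
  rw [show d * n / (d / n * n ^ 2) = 1 by field_simp] at key
  have hK := cliqueSum_one_le G (k + 3)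
  have hfac : (0 : ℝ) < (k + 3).factorial := by exact_mod_cast Nat.factorial_pos _
  have hcount' := mul_le_mul_of_nonneg_left hcount hfac.le
  have hch : (k + 3).choose 2 = (k + 2).choose 2 + (k + 2) := by
    have : (k + 3).choose 2 = (k + 2).choose 1 + (k + 2).choose 2 := Nat.choose_succ_succ' (k + 2) 1
    rw [Nat.choose_one_right] at this
    omega
  rw [← Nat.choose_two_right] at hcount'
  have e1 : ((k + 3).factorial : ℝ) * ((1 - ε) * (n ^ (k + 3) / (k + 3).factorial) *
      (d / n) ^ (k + 3).choose 2) = (1 - ε) * (n ^ (k + 3) * (d / n) ^ (k + 3).choose 2) := by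
    field_simp
  rw [e1] at hcount'
  have e2 : n ^ (k + 3) * (d / n) ^ (k + 3).choose 2 =
      d ^ (k + 2) / n ^ k * (n ^ (k + 1) * (d / n) ^ (k + 2).choose 2) := by
    rw [hch, pow_add (d / n), div_pow d n (k + 2)]
    field_simp
    ring
  rw [show k + 1 + 2 = k + 3 from rfl] at key
  rw [e2] at hcount' key
  have hmain : ε / 2 * (d ^ (k + 2) / n ^ k) ≤ C * (4 * surplus G) := by
    refine le_of_mul_le_mul_right ?_ hD
    linarith
  have hX : 0 ≤ d ^ (k + 2) / n ^ k := by positivity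
  rw [ge_iff_le, mul_div_assoc, div_mul_eq_mul_div, div_le_iff₀ (by positivity)]
  linarith

end MaxCutPaper
end

section
/- There exist absolute constants c, C > 0 such that the following holds. Let G be a strongly regular finite simple graph with n vertices and degree d ≤ 0.99·n (i.e., G is d-regular, every pair of adjacent vertices has the same number η of common neighbours, and every pair of distinct non-adjacent vertices has the same number μ of common neighbours), and suppose G has exactly d³/6 + s triangles. Then: (i) if s < −n·d^(3/2), then c·|s|/d ≤ sp(G) ≤ C·|s|/d; (ii) if −n·d^(3/2) ≤ s ≤ n·d^(3/2), then c·n·d^(1/2) ≤ sp(G) ≤ C·n·d^(1/2); (iii) if s > n·d^(3/2), then c·n²·d²/s ≤ sp(G) ≤ C·n²·d²/s. -/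
namespace MaxCutPaper

variable {V : Type*}

open MeasureTheory ProbabilityTheory in
theorem integral_cos_inner_stdGaussian {E : Type*} [NormedAddCommGroup E]
    [InnerProductSpace ℝ E] [FiniteDimensional ℝ E] [MeasurableSpace E] [BorelSpace E] (a : E) :
    ∫ x, Real.cos (inner ℝ x a) ∂(stdGaussian E) = Real.exp (-‖a‖ ^ 2 / 2) := by
  have h := congrArg Complex.re (charFun_stdGaussian a)
  rw [charFun_apply, ← RCLike.re_eq_complex_re, ← integral_re] at h
  · have h2 : Complex.exp (-(‖a‖ : ℂ) ^ 2 / 2) = ((Real.exp (-‖a‖ ^ 2 / 2) : ℝ) : ℂ) := by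
      push_cast; rfl
    rw [h2] at h
    rw [RCLike.re_eq_complex_re, Complex.ofReal_re] at h
    simpa only [RCLike.re_eq_complex_re, Complex.exp_ofReal_mul_I_re] using h
  · refine Integrable.of_bound (C := 1) (by fun_prop) (ae_of_all _ fun x => ?_)
    rw [Complex.norm_exp_ofReal_mul_I]

open MeasureTheory ProbabilityTheory in
theorem integral_sin_inner_mul_sin_inner_stdGaussian {E : Type*} [NormedAddCommGroup E]
    [InnerProductSpace ℝ E] [FiniteDimensional ℝ E] [MeasurableSpace E] [BorelSpace E] (a b : E) :
    ∫ x, Real.sin (inner ℝ x a) * Real.sin (inner ℝ x b) ∂(stdGaussian E) =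
      (Real.exp (-‖a - b‖ ^ 2 / 2) - Real.exp (-‖a + b‖ ^ 2 / 2)) / 2 := by
  have hint (c : E) : Integrable (fun x => Real.cos (inner ℝ x c)) (stdGaussian E) :=
    Integrable.of_bound (C := 1) (by fun_prop) (ae_of_all _ fun x => by
      simpa using Real.abs_cos_le_one _)
  rw [← integral_cos_inner_stdGaussian, ← integral_cos_inner_stdGaussian,
    ← integral_sub (hint _) (hint _), ← integral_div]
  congr 1 with x
  rw [inner_sub_right, inner_add_right, Real.cos_sub, Real.cos_add]
  ring

open Matrix in
/-- A quadratic form with zero diagonal attains its minimum over the cube at a vertex. -/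
theorem exists_sign_dotProduct_mulVec_le {V : Type*} [Fintype V] (A : Matrix V V ℝ)
    (hA : A.IsSymm) (hdiag : ∀ v, A v v = 0) (y : V → ℝ) (hy : ∀ v, |y v| ≤ 1) :
    ∃ z : V → ℝ, (∀ v, z v = 1 ∨ z v = -1) ∧ z ⬝ᵥ A *ᵥ z ≤ y ⬝ᵥ A *ᵥ y := by
  classical
  have key : ∀ s : Finset V, ∃ z : V → ℝ, (∀ v, |z v| ≤ 1) ∧ (∀ v ∈ s, z v = 1 ∨ z v = -1) ∧
      z ⬝ᵥ A *ᵥ z ≤ y ⬝ᵥ A *ᵥ y := by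
    intro s
    induction s using Finset.induction_on with
    | empty => exact ⟨y, hy, by simp, le_rfl⟩
    | insert u s hu ih =>
      obtain ⟨z, hz1, hzs, hz⟩ := ih
      have step (c : ℝ) : (z + Pi.single u c) ⬝ᵥ A *ᵥ (z + Pi.single u c) =
          z ⬝ᵥ A *ᵥ z + 2 * c * (A *ᵥ z) u := by
        have h1 : z ⬝ᵥ A *ᵥ (Pi.single u c) = c * (A *ᵥ z) u := by
          rw [dotProduct_mulVec, ← mulVec_transpose, hA.eq, dotProduct_single, mul_comm]
        rw [mulVec_add, dotProduct_add, add_dotProduct, add_dotProduct, h1, single_dotProduct,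
          single_dotProduct, mulVec_single]
        simp [hdiag]
        ring
      have hz' := abs_le.1 (hz1 u)
      obtain ⟨e, he, hle⟩ : ∃ e : ℝ, (e = 1 ∨ e = -1) ∧ (e - z u) * (A *ᵥ z) u ≤ 0 := by
        rcases le_total 0 ((A *ᵥ z) u) with h | h
        · exact ⟨-1, .inr rfl, mul_nonpos_of_nonpos_of_nonneg (by linarith) h⟩
        · exact ⟨1, .inl rfl, mul_nonpos_of_nonneg_of_nonpos (by linarith) h⟩
      have hval (v : V) : (z + Pi.single u (e - z u) : V → ℝ) v = if v = u then e else z v := by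
        by_cases hv : v = u
        · subst hv; simp
        · simp [hv]
      refine ⟨z + Pi.single u (e - z u), fun v => ?_, fun v hv => ?_, ?_⟩
      · rw [hval]
        split_ifs
        · rcases he with rfl | rfl <;> simp
        · exact hz1 v
      · rw [hval]
        split_ifs with h
        · exact he
        · exact hzs v ((Finset.mem_insert.1 hv).resolve_left h)
      · rw [step]
        linarith
  obtain ⟨z, -, h1, h2⟩ := key Finset.univ
  exact ⟨z, fun v => h1 v (Finset.mem_univ v), h2⟩

open Matrix MeasureTheory ProbabilityTheory in
/-- Rounding of a vector solution of the max-cut relaxation. -/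
theorem exists_sign_dotProduct_mulVec_le_of_inner_le {V E : Type*} [Fintype V]
    [NormedAddCommGroup E] [InnerProductSpace ℝ E] [FiniteDimensional ℝ E]
    (A : Matrix V V ℝ) (hA : A.IsSymm) (hdiag : ∀ v, A v v = 0) (hnonneg : ∀ u v, 0 ≤ A u v)
    (w : V → E) (hw : ∀ v, ‖w v‖ = 1) (ρ : ℝ) (hρ : 0 ≤ ρ)
    (hin : ∀ u v, A u v ≠ 0 → inner ℝ (w u) (w v) = -ρ) :
    ∃ z : V → ℝ, (∀ v, z v = 1 ∨ z v = -1) ∧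
      z ⬝ᵥ A *ᵥ z ≤ -(ρ * Real.exp (-1)) * ∑ u, ∑ v, A u v := by
  borelize E
  let y (x : E) (v : V) : ℝ := Real.sin (inner ℝ x (w v))
  have hint (u v : V) : Integrable (fun x => A u v * (y x u * y x v)) (stdGaussian E) := by
    refine Integrable.const_mul (Integrable.of_bound (C := 1) (by fun_prop)
      (ae_of_all _ fun x => ?_)) _
    rw [norm_mul]
    exact mul_le_one₀ (Real.abs_sin_le_one _) (norm_nonneg _) (Real.abs_sin_le_one _)
  have hexpand (x : E) : y x ⬝ᵥ A *ᵥ y x = ∑ u, ∑ v, A u v * (y x u * y x v) := by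
    simp only [dotProduct, mulVec, Finset.mul_sum]
    exact Finset.sum_congr rfl fun u _ => Finset.sum_congr rfl fun v _ => by ring
  have hterm (u v : V) : ∫ x, A u v * (y x u * y x v) ∂(stdGaussian E) ≤
      -(ρ * Real.exp (-1)) * A u v := by
    rw [integral_const_mul, integral_sin_inner_mul_sin_inner_stdGaussian]
    by_cases h0 : A u v = 0
    · simp [h0]
    rw [mul_comm]
    refine mul_le_mul_of_nonneg_right ?_ (hnonneg u v)
    rw [norm_sub_sq_real, norm_add_sq_real, hw, hw, hin u v h0]
    have h1 : Real.exp (-(1 ^ 2 - 2 * -ρ + 1 ^ 2) / 2) = Real.exp (-1) * Real.exp (-ρ) := by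
      rw [← Real.exp_add]; congr 1; ring
    have h2 : Real.exp (-(1 ^ 2 + 2 * -ρ + 1 ^ 2) / 2) = Real.exp (-1) * Real.exp ρ := by
      rw [← Real.exp_add]; congr 1; ring
    rw [h1, h2]
    have h3 : ρ ≤ Real.sinh ρ := Real.self_le_sinh_iff.2 hρ
    rw [Real.sinh_eq] at h3
    nlinarith [Real.exp_pos (-1)]
  have htotal : ∫ x, y x ⬝ᵥ A *ᵥ y x ∂(stdGaussian E) ≤
      -(ρ * Real.exp (-1)) * ∑ u, ∑ v, A u v := by
    simp_rw [hexpand]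
    rw [integral_finsetSum _ fun u _ => integrable_finsetSum _ fun v _ => hint u v,
      Finset.mul_sum]
    refine Finset.sum_le_sum fun u _ => ?_
    rw [integral_finsetSum _ fun v _ => hint u v, Finset.mul_sum]
    exact Finset.sum_le_sum fun v _ => hterm u v
  obtain ⟨x, hx⟩ := exists_le_integral (μ := stdGaussian E) (f := fun x => y x ⬝ᵥ A *ᵥ y x) (by
    simp_rw [hexpand]
    exact integrable_finsetSum _ fun u _ => integrable_finsetSum _ fun v _ => hint u v)
  obtain ⟨z, hz, hle⟩ := exists_sign_dotProduct_mulVec_le A hA hdiag (y x)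
    fun v => Real.abs_sin_le_one _
  exact ⟨z, hz, hle.trans (hx.trans htotal)⟩

open Matrix in
theorem four_mul_cutSize [Fintype V] [DecidableEq V] (G : SimpleGraph V) [DecidableRel G.Adj]
    (d : ℕ) (hd : G.IsRegularOfDegree d) (z : V → ℝ) (S : Finset V)
    (hz : ∀ v, z v = if v ∈ S then 1 else -1) :
    4 * (cutSize G S : ℝ) = Fintype.card V * d - z ⬝ᵥ G.adjMatrix ℝ *ᵥ z := by
  have h1 : (cutSize G S : ℝ) =
      ∑ u, ∑ v, (if u ∈ S ∧ v ∉ S ∧ G.Adj u v then (1 : ℝ) else 0) := by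
    rw [cutSize, Nat.card_eq_fintype_card, Fintype.card_subtype, Finset.card_filter,
      Fintype.sum_prod_type]
    push_cast
    rfl
  have h2 (u v : V) : 4 * (if u ∈ S ∧ v ∉ S ∧ G.Adj u v then (1 : ℝ) else 0) =
      (G.adjMatrix ℝ u v - z u * (G.adjMatrix ℝ u v * z v)) +
        (z u * G.adjMatrix ℝ u v - G.adjMatrix ℝ u v * z v) := by
    rw [hz, hz, SimpleGraph.adjMatrix_apply]
    by_cases hu : u ∈ S <;> by_cases hv : v ∈ S <;> by_cases ha : G.Adj u v <;>
      norm_num [hu, hv, ha]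
  have hrow (u : V) : ∑ v, G.adjMatrix ℝ u v = d := by
    simp [SimpleGraph.adjMatrix_apply, ← SimpleGraph.neighborFinset_eq_filter, hd.degree_eq u]
  have hanti : ∑ u, ∑ v, (z u * G.adjMatrix ℝ u v - G.adjMatrix ℝ u v * z v) = 0 := by
    simp only [Finset.sum_sub_distrib]
    rw [sub_eq_zero, Finset.sum_comm]
    refine Finset.sum_congr rfl fun u _ => Finset.sum_congr rfl fun v _ => ?_
    rw [← G.isSymm_adjMatrix.apply u v, mul_comm]
  rw [h1, Finset.mul_sum]
  simp only [Finset.mul_sum, h2]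
  simp only [Finset.sum_add_distrib, hanti, add_zero]
  simp only [Finset.sum_sub_distrib, hrow, dotProduct, mulVec, Finset.mul_sum]
  simp

theorem two_mul_edgeCount [Fintype V] [DecidableEq V] (G : SimpleGraph V) [DecidableRel G.Adj]
    (d : ℕ) (hd : G.IsRegularOfDegree d) :
    2 * (edgeCount G : ℝ) = Fintype.card V * d := by
  have h := G.sum_degrees_eq_twice_card_edges
  simp only [hd.degree_eq, Finset.sum_const, Finset.card_univ, smul_eq_mul] at h
  rw [edgeCount, Nat.card_eq_fintype_card, ← SimpleGraph.edgeFinset_card]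
  exact_mod_cast h.symm

open Matrix in
theorem neg_dotProduct_le_surplus [Fintype V] [DecidableEq V] (G : SimpleGraph V)
    [DecidableRel G.Adj] (d : ℕ) (hd : G.IsRegularOfDegree d) (z : V → ℝ)
    (hz : ∀ v, z v = 1 ∨ z v = -1) :
    -(z ⬝ᵥ G.adjMatrix ℝ *ᵥ z) / 4 ≤ surplus G := by
  have h1 := four_mul_cutSize G d hd z (Finset.univ.filter fun v => z v = 1) fun v => by
    rcases hz v with h | h <;> simp [h]
  have h2 : (cutSize G (Finset.univ.filter fun v => z v = 1) : ℝ) ≤ maxCut G := by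
    exact_mod_cast Finset.le_sup (f := cutSize G) (by simp)
  rw [surplus]
  linarith [two_mul_edgeCount G d hd]

open Matrix in
theorem surplus_le_of_forall_sign [Fintype V] [DecidableEq V] (G : SimpleGraph V)
    [DecidableRel G.Adj] (d : ℕ) (hd : G.IsRegularOfDegree d) (b : ℝ)
    (hb : ∀ z : V → ℝ, (∀ v, z v = 1 ∨ z v = -1) → -b ≤ z ⬝ᵥ G.adjMatrix ℝ *ᵥ z) :
    surplus G ≤ b / 4 := by
  obtain ⟨S, -, hS⟩ := Finset.exists_mem_eq_sup (Finset.univ : Finset V).powerset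
    (Finset.powerset_nonempty _) (cutSize G)
  have h1 := four_mul_cutSize G d hd (fun v => if v ∈ S then 1 else -1) S fun v => rfl
  have h2 := hb (fun v => if v ∈ S then 1 else -1) fun v => by
    by_cases h : v ∈ S <;> simp [h]
  rw [surplus, maxCut, hS]
  linarith [two_mul_edgeCount G d hd]

theorem six_mul_cliqueCount_three [Fintype V] [DecidableEq V] (G : SimpleGraph V)
    [DecidableRel G.Adj] (d η : ℕ) (hd : G.IsRegularOfDegree d)
    (hη : ∀ u v, G.Adj u v → Fintype.card (G.commonNeighbors u v) = η) :
    6 * cliqueCount G 3 = Fintype.card V * d * η := by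
  have hcount : cliqueCount G 3 = (G.cliqueFinset 3).card := by
    rw [cliqueCount, Nat.card_eq_fintype_card, Fintype.card_subtype]
    rfl
  have h := Finset.sum_card_bipartiteAbove_eq_sum_card_bipartiteBelow
    (s := Finset.univ.filter fun p : V × V => G.Adj p.1 p.2) (t := G.cliqueFinset 3)
    (fun p s => p.1 ∈ s ∧ p.2 ∈ s)
  have hbelow : ∀ T ∈ G.cliqueFinset 3, (Finset.bipartiteBelow (fun p s => p.1 ∈ s ∧ p.2 ∈ s)
      (Finset.univ.filter fun p : V × V => G.Adj p.1 p.2) T).card = 6 := by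
    intro T hT
    rw [SimpleGraph.mem_cliqueFinset_iff] at hT
    have : Finset.bipartiteBelow (fun p s => p.1 ∈ s ∧ p.2 ∈ s)
        (Finset.univ.filter fun p : V × V => G.Adj p.1 p.2) T = T.offDiag := by
      ext ⟨u, v⟩
      simp only [Finset.mem_bipartiteBelow, Finset.mem_filter, Finset.mem_univ, true_and,
        Finset.mem_offDiag]
      exact ⟨fun h => ⟨h.2.1, h.2.2, h.1.ne⟩,
        fun h => ⟨hT.isClique h.1 h.2.1 h.2.2, h.1, h.2.1⟩⟩
    rw [this, Finset.offDiag_card, hT.card_eq]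
  have habove : ∀ p ∈ Finset.univ.filter (fun p : V × V => G.Adj p.1 p.2),
      (Finset.bipartiteAbove (fun p s => p.1 ∈ s ∧ p.2 ∈ s) (G.cliqueFinset 3) p).card = η := by
    rintro ⟨u, v⟩ huv
    simp only [Finset.mem_filter, Finset.mem_univ, true_and] at huv
    rw [← hη u v huv, ← Set.toFinset_card]
    symm
    refine Finset.card_bij (fun w _ => {u, v, w}) ?_ ?_ ?_
    · intro w hw
      rw [Set.mem_toFinset, SimpleGraph.mem_commonNeighbors] at hw
      simp only [Finset.mem_bipartiteAbove, SimpleGraph.mem_cliqueFinset_iff]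
      exact ⟨SimpleGraph.is3Clique_iff.2 ⟨u, v, w, huv, hw.1, hw.2, rfl⟩, by simp, by simp⟩
    · intro w hw w' hw' heq
      rw [Set.mem_toFinset, SimpleGraph.mem_commonNeighbors] at hw hw'
      have : w ∈ ({u, v, w'} : Finset V) := heq ▸ (by simp)
      simpa [hw.1.ne', hw.2.ne'] using this
    · intro T hT
      simp only [Finset.mem_bipartiteAbove, SimpleGraph.mem_cliqueFinset_iff] at hT
      obtain ⟨hT, hu, hv⟩ := hT
      have hc : ((T.erase u).erase v).card = 1 := by
        rw [Finset.card_erase_of_mem (Finset.mem_erase.2 ⟨huv.ne', hv⟩),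
          Finset.card_erase_of_mem hu, hT.card_eq]
      obtain ⟨w, hw⟩ := Finset.card_eq_one.1 hc
      have hwT : w ∈ (T.erase u).erase v := hw ▸ Finset.mem_singleton_self w
      simp only [Finset.mem_erase] at hwT
      refine ⟨w, ?_, ?_⟩
      · rw [Set.mem_toFinset, SimpleGraph.mem_commonNeighbors]
        exact ⟨hT.isClique hu hwT.2.2 hwT.2.1.symm, hT.isClique hv hwT.2.2 hwT.1.symm⟩
      · rw [← hw, Finset.insert_erase (Finset.mem_erase.2 ⟨huv.ne', hv⟩),
          Finset.insert_erase hu]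
  have hpairs : (Finset.univ.filter fun p : V × V => G.Adj p.1 p.2).card =
      Fintype.card V * d := by
    rw [Finset.card_filter, Fintype.sum_prod_type]
    simp [← SimpleGraph.neighborFinset_eq_filter, hd.degree_eq]
  rw [Finset.sum_congr rfl hbelow, Finset.sum_congr rfl habove, Finset.sum_const,
    Finset.sum_const, hpairs, smul_eq_mul, smul_eq_mul] at h
  rw [hcount, h, mul_comm]

variable (V) in
/-- The all-ones matrix. -/
abbrev allOnes : Matrix V V ℝ := Matrix.of fun _ _ => 1

theorem allOnes_mul_allOnes [Fintype V] :
    allOnes V * allOnes V = (Fintype.card V : ℝ) • allOnes V := by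
  ext u v
  simp [Matrix.mul_apply]

open Matrix in
/-- The unnormalised spectral projection `r - A + ((d - r) / n) J` of the adjacency matrix of a
strongly regular graph onto the eigenspace of `-t`. -/
theorem spectral_projection_mul [Fintype V] [DecidableEq V] (A : Matrix V V ℝ) (d m r t κ : ℝ)
    (hAJ : A * allOnes V = d • allOnes V) (hJA : allOnes V * A = d • allOnes V)
    (hA2 : A * A = (r * t) • (1 : Matrix V V ℝ) + (r - t) • A + m • allOnes V)
    (hκ : κ * Fintype.card V = d - r) (hm : κ * (d + t) = m) :
    (r • (1 : Matrix V V ℝ) - A + κ • allOnes V) * (r • (1 : Matrix V V ℝ) - A + κ • allOnes V) =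
      (r + t) • (r • (1 : Matrix V V ℝ) - A + κ • allOnes V) := by
  simp only [add_mul, mul_add, sub_mul, mul_sub, smul_mul_assoc, mul_smul_comm, one_mul, mul_one,
    hAJ, hJA, hA2, allOnes_mul_allOnes]
  ext u v
  simp only [Matrix.add_apply, Matrix.sub_apply, Matrix.smul_apply, smul_eq_mul, Matrix.of_apply]
  linear_combination κ * hκ - hm

/-- Parameters of a strongly regular graph with positive degree, expressed through the nontrivial
eigenvalues `r` and `-t` of its adjacency matrix `A`. -/
structure EigenData [Fintype V] [DecidableEq V] (A : Matrix V V ℝ) (d m r t : ℝ) : Prop where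
  pos : 1 ≤ d
  r_nonneg : 0 ≤ r
  t_nonneg : 0 ≤ t
  add_pos : 0 < r + t
  m_nonneg : 0 ≤ m
  mul_eq : r * t = d - m
  mul_card : (d - r) * (d + t) = m * Fintype.card V
  isSymm : A.IsSymm
  mul_ones : A * allOnes V = d • allOnes V
  ones_mul : allOnes V * A = d • allOnes V
  sq_eq : A * A = (r * t) • (1 : Matrix V V ℝ) + (r - t) • A + m • allOnes V

open Matrix in
theorem EigenData.neg_le_dotProduct [Fintype V] [DecidableEq V] {A : Matrix V V ℝ} {d m r t : ℝ}
    (h : EigenData A d m r t) (hn : 0 < Fintype.card V) (z : V → ℝ)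
    (hz : ∀ v, z v = 1 ∨ z v = -1) :
    -(Fintype.card V * t) ≤ z ⬝ᵥ A *ᵥ z := by
  have hn' : (0 : ℝ) < Fintype.card V := by exact_mod_cast hn
  have hd := h.pos
  have ht := h.t_nonneg
  let κ := (d + t) / Fintype.card V
  have hκ0 : 0 ≤ κ := by positivity
  let C := (-t) • (1 : Matrix V V ℝ) - A + κ • allOnes V
  have hC : C * C = (-t + -r) • C :=
    spectral_projection_mul A d m (-t) (-r) κ h.mul_ones h.ones_mul
      (by rw [h.sq_eq]; congr 3 <;> ring) (by simp only [κ]; field_simp; ring) (by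
        have := h.mul_card
        simp only [κ]
        field_simp
        linarith)
  have hCs : C.IsSymm := by
    ext u v
    simp [C, h.isSymm.apply u v, Matrix.one_apply, eq_comm]
  have h1 : z ⬝ᵥ (C * C) *ᵥ z = (C *ᵥ z) ⬝ᵥ (C *ᵥ z) := by
    rw [← mulVec_mulVec, dotProduct_mulVec, ← mulVec_transpose, hCs.eq]
  have h2 : 0 ≤ (C *ᵥ z) ⬝ᵥ (C *ᵥ z) := Finset.sum_nonneg fun v _ => mul_self_nonneg _
  rw [← h1, hC, smul_mulVec, dotProduct_smul, smul_eq_mul] at h2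
  have h3 : z ⬝ᵥ C *ᵥ z ≤ 0 := by
    by_contra! hcon
    nlinarith [h.add_pos]
  have hzz : z ⬝ᵥ z = Fintype.card V := by
    have (v : V) : z v * z v = 1 := by rcases hz v with h | h <;> simp [h]
    simp [dotProduct, this]
  have hJ : z ⬝ᵥ allOnes V *ᵥ z = (∑ v, z v) ^ 2 := by
    simp [dotProduct, mulVec, ← Finset.sum_mul, sq]
  simp only [C, add_mulVec, sub_mulVec, smul_mulVec, one_mulVec, dotProduct_add, dotProduct_sub,
    dotProduct_smul, smul_eq_mul, hzz, hJ] at h3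
  have h4 : 0 ≤ κ * (∑ v, z v) ^ 2 := by positivity
  linarith

open Matrix in
theorem EigenData.exists_sign_dotProduct_le [Fintype V] [DecidableEq V] {A : Matrix V V ℝ}
    {d m r t : ℝ}
    (h : EigenData A d m r t) (hn : 0 < Fintype.card V) (hdiag : ∀ v, A v v = 0)
    (h01 : ∀ u v, A u v = 0 ∨ A u v = 1) :
    ∃ z : V → ℝ, (∀ v, z v = 1 ∨ z v = -1) ∧
      z ⬝ᵥ A *ᵥ z ≤ -(Real.exp (-1) * (Fintype.card V * t)) := by
  have hn' : (0 : ℝ) < Fintype.card V := by exact_mod_cast hn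
  have hd := h.pos
  have ht := h.t_nonneg
  have hr := h.r_nonneg
  have hrt := h.add_pos
  have hm := h.m_nonneg
  let κ := (d - r) / Fintype.card V
  have hκm : κ * (d + t) = m := by
    have := h.mul_card
    simp only [κ]
    field_simp
    linarith
  have hκ0 : 0 ≤ κ := by
    by_contra! hcon
    nlinarith
  have hb : 0 < r + κ := by
    rcases hr.eq_or_lt with h0 | h0
    · have := h.mul_eq
      rw [← h0, zero_mul] at this
      by_contra! hcon
      have : κ = 0 := by linarith
      rw [this] at hκm
      linarith
    · linarith
  let B := r • (1 : Matrix V V ℝ) - A + κ • allOnes V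
  have hB : B * B = (r + t) • B :=
    spectral_projection_mul A d m r t κ h.mul_ones h.ones_mul h.sq_eq
      (by simp only [κ]; field_simp) hκm
  have hBs (u v : V) : B u v = B v u := by
    simp [B, h.isSymm.apply u v, Matrix.one_apply, eq_comm]
  let α := (Real.sqrt ((r + t) * (r + κ)))⁻¹
  have hα : α * α * ((r + t) * (r + κ)) = 1 := by
    have hpos : 0 < (r + t) * (r + κ) := mul_pos hrt hb
    have := Real.mul_self_sqrt hpos.le
    simp only [α]
    rw [← mul_inv, this, inv_mul_cancel₀ hpos.ne']
  let w (u : V) : EuclideanSpace ℝ V := α • WithLp.toLp 2 (B u)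
  have hw (u v : V) : inner ℝ (w u) (w v) = α * α * ((r + t) * B u v) := by
    have : (B * B) u v = (r + t) * B u v := by rw [hB]; rfl
    rw [← this, inner_smul_left, inner_smul_right, EuclideanSpace.inner_toLp_toLp,
      Matrix.mul_apply]
    simp only [dotProduct, hBs _ v, star_trivial, conj_trivial]
    rw [mul_assoc]
    congr 2
    exact Finset.sum_congr rfl fun x _ => mul_comm _ _
  have hdiagB (v : V) : B v v = r + κ := by simp [B, hdiag]
  obtain ⟨z, hz, hle⟩ := exists_sign_dotProduct_mulVec_le_of_inner_le A h.isSymm hdiag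
    (fun u v => by rcases h01 u v with h | h <;> simp [h]) w (fun v => by
      have h1 : ‖w v‖ ^ 2 = 1 := by
        rw [← real_inner_self_eq_norm_sq, hw, hdiagB, hα]
      exact (pow_eq_one_iff_of_nonneg (norm_nonneg _) two_ne_zero).1 h1)
    (t / d) (by positivity) (fun u v huv => by
      have h1 : A u v = 1 := (h01 u v).resolve_left huv
      have huv' : u ≠ v := fun e => huv (e ▸ hdiag u)
      have h2 : B u v = κ - 1 := by simp [B, h1, huv']; ring
      have h3 : d * (κ - 1) = -t * (r + κ) := by linarith [h.mul_eq]
      rw [hw, h2, eq_neg_iff_add_eq_zero]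
      have h4 : (κ - 1) = -(t / d) * (r + κ) := by field_simp; linarith
      rw [h4]
      linear_combination -(t / d) * hα)
  refine ⟨z, hz, hle.trans_eq ?_⟩
  have hrow (u : V) : ∑ v, A u v = d := by
    have := congrFun (congrFun h.mul_ones u) u
    simpa [Matrix.mul_apply] using this
  simp only [hrow, Finset.sum_const, Finset.card_univ, nsmul_eq_mul]
  field_simp

theorem EigenData.surplus_bounds [Fintype V] [DecidableEq V] {G : SimpleGraph V}
    [DecidableRel G.Adj] {d : ℕ} {m r t : ℝ} (hG : G.IsRegularOfDegree d)
    (h : EigenData (G.adjMatrix ℝ) d m r t) (hn : 0 < Fintype.card V) :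
    Real.exp (-1) / 4 * (Fintype.card V * t) ≤ surplus G ∧
      surplus G ≤ Fintype.card V * t / 4 := by
  obtain ⟨z, hz, hle⟩ := h.exists_sign_dotProduct_le hn (by simp) fun u v => by
    by_cases h : G.Adj u v <;> simp [h]
  exact ⟨by linarith [neg_dotProduct_le_surplus G d hG z hz],
    surplus_le_of_forall_sign G d hG _ fun z hz => h.neg_le_dotProduct hn z hz⟩

open Matrix in
theorem exists_eigenData [Fintype V] [DecidableEq V] {G : SimpleGraph V} [DecidableRel G.Adj]
    {d η μ : ℕ} (hG : G.IsSRGWith (Fintype.card V) d η μ) (hd : 1 ≤ d) (hn : 0 < Fintype.card V)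
    (hη : η < d) (hμ : μ ≤ d) :
    ∃ r t : ℝ, r - t = (η : ℝ) - μ ∧ EigenData (G.adjMatrix ℝ) d μ r t := by
  have hd' : (1 : ℝ) ≤ d := by exact_mod_cast hd
  have hη' : (η : ℝ) + 1 ≤ d := by exact_mod_cast hη
  have hμ' : (μ : ℝ) ≤ d := by exact_mod_cast hμ
  have hμ0 : (0 : ℝ) ≤ μ := by positivity
  let β : ℝ := (η : ℝ) - μ
  let Δ := Real.sqrt (β ^ 2 + 4 * (d - μ))
  have hΔ : Δ ^ 2 = β ^ 2 + 4 * (d - μ) := Real.sq_sqrt (by nlinarith [sq_nonneg β])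
  have hΔβ : |β| ≤ Δ := Real.abs_le_sqrt (by linarith)
  have hΔ0 : 0 < Δ := by
    apply Real.sqrt_pos.2
    rcases hμ'.eq_or_lt with h | h
    · have : β ≤ -1 := by simp only [β]; linarith
      nlinarith
    · nlinarith [sq_nonneg β]
  obtain ⟨hβ1, hβ2⟩ := abs_le.1 hΔβ
  let r := (Δ + β) / 2
  let t := (Δ - β) / 2
  have hrt : r * t = d - μ := by simp only [r, t]; linarith
  have hsub : r - t = β := by simp only [r, t]; ring
  have hrow (u : V) : ∑ v, G.adjMatrix ℝ u v = d := by
    simp [SimpleGraph.adjMatrix_apply, ← SimpleGraph.neighborFinset_eq_filter,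
      hG.regular.degree_eq u]
  have hAJ : G.adjMatrix ℝ * allOnes V = (d : ℝ) • allOnes V := by
    ext u v
    simp only [Matrix.mul_apply, Matrix.of_apply, mul_one, hrow]
    simp
  have hJA : allOnes V * G.adjMatrix ℝ = (d : ℝ) • allOnes V := by
    ext u v
    simp only [Matrix.mul_apply, Matrix.of_apply, one_mul]
    rw [Finset.sum_congr rfl fun x _ => G.isSymm_adjMatrix.apply v x, hrow]
    simp
  have hsq : G.adjMatrix ℝ * G.adjMatrix ℝ =
      (r * t) • (1 : Matrix V V ℝ) + (r - t) • G.adjMatrix ℝ + (μ : ℝ) • allOnes V := by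
    rw [← sq, hG.matrix_eq, hrt, hsub]
    simp only [← Nat.cast_smul_eq_nsmul ℝ]
    ext u v
    by_cases huv : u = v
    · subst huv; simp
    · by_cases ha : G.Adj u v <;> simp [huv, ha, β]
  refine ⟨r, t, hsub, hd', by simp only [r]; linarith, by simp only [t]; linarith, ?_, hμ0, hrt,
    ?_, G.isSymm_adjMatrix, hAJ, hJA, hsq⟩
  · simp only [r, t]; linarith
  · have h1 := congrArg (· * allOnes V) hsq
    simp only [add_mul, smul_mul_assoc, one_mul, Matrix.mul_assoc, hAJ, mul_smul_comm,
      allOnes_mul_allOnes] at h1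
    obtain ⟨u⟩ := Fintype.card_pos_iff.1 hn
    have h2 := congrFun (congrFun h1 u) u
    simp at h2
    linarith

section Parameters

variable {n d r t x q : ℝ}

/-- The case of many fewer triangles than in a random graph; here `-x` is the normalised triangle
excess. -/
theorem eigenvalue_bounds_of_lt_neg (hr : 0 ≤ r) (ht : 0 ≤ t) (hq : 1 ≤ q) (hd : d = q ^ 2)
    (hdn : d ≤ 0.99 * n) (hrt : r * t ≤ d) (hx : x = (n - d) * (t - r) + r * t)
    (h : 6 * n * q < x) : x / 1000 ≤ n * t ∧ n * t ≤ 500 * x := by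
  have hn : 1 ≤ n := by nlinarith
  have h1 : 5 * (n * q) ≤ (n - d) * (t - r) := by nlinarith
  have h2 : 0 < t - r := by
    by_contra! hcon
    nlinarith
  have h3 : 5 * q ≤ t := by nlinarith
  have h4 : r ≤ t / 25 := by
    by_contra! hcon
    have : 5 * q * (5 * q) ≤ t * t := mul_self_le_mul_self (by linarith) h3
    nlinarith
  have h5 : 0 ≤ (n - d - 0.01 * n) * (t - r) := mul_nonneg (by linarith) h2.le
  have h6 : 0 ≤ d * (t - r) := mul_nonneg (by nlinarith) h2.le
  have h7 : 0 ≤ n * (t / 25 - r) := mul_nonneg (by linarith) (by linarith)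
  have h8 : 0 ≤ n * (t - 1) := mul_nonneg (by linarith) (by linarith)
  have h9 : 0 ≤ n * r := by positivity
  have h10 : 0 ≤ r * t := by positivity
  constructor <;> nlinarith

/-- The case of about as many triangles as in a random graph. -/
theorem eigenvalue_bounds_of_abs_le (hr : 0 ≤ r) (ht : 0 ≤ t) (hq : 1 ≤ q) (hd : d = q ^ 2)
    (hdn : d ≤ 0.99 * n) (hrt : r * t ≤ d)
    (htr : (n - 1) * (r * t) = d * (n - d) + d * (r - t))
    (hx : x = (n - d) * (t - r) + r * t) (h1 : x ≤ 6 * n * q) (h2 : -(6 * n * q) ≤ x) :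
    n * q / 100000 ≤ n * t ∧ n * t ≤ 1000 * (n * q) := by
  have hn : 1 ≤ n := by nlinarith
  have hqn : 0 ≤ n * q := by nlinarith
  have hrt0 : 0 ≤ r * t := by positivity
  suffices q / 100000 ≤ t ∧ t ≤ 1000 * q by
    constructor <;> nlinarith
  have hnrt : d * (n - d) + d * (r - t) ≤ n * (r * t) := by linarith
  rcases le_total t r with h | h
  · have h3 : 0 ≤ (n - d - 0.01 * n) * (r - t) := mul_nonneg (by linarith) (by linarith)
    have h4 : t ≤ q := abs_le_of_sq_le_sq' (by nlinarith) (by linarith) |>.2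
    have h5 : n * (r - t) ≤ n * (700 * q) := by nlinarith
    have h6 : r - t ≤ 700 * q := le_of_mul_le_mul_left h5 (by linarith)
    have h7 : n * (0.01 * d) ≤ n * (r * t) := by
      nlinarith [mul_nonneg (sq_nonneg q) (sub_nonneg.2 h)]
    have h8 : 0.01 * d ≤ r * t := le_of_mul_le_mul_left h7 (by linarith)
    have h9 : r * t ≤ 701 * q * t := mul_le_mul_of_nonneg_right (by linarith) ht
    have h10 : q * (0.01 * q) ≤ q * (701 * t) := by nlinarith
    have h11 : 0.01 * q ≤ 701 * t := le_of_mul_le_mul_left h10 (by linarith)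
    constructor <;> linarith
  · have h3 : 0 ≤ (n - d - 0.01 * n) * (t - r) := mul_nonneg (by linarith) (by linarith)
    have h4 : r ≤ q := abs_le_of_sq_le_sq' (by nlinarith) (by linarith) |>.2
    have h5 : n * (t - r) ≤ n * (700 * q) := by nlinarith
    have h6 : t - r ≤ 700 * q := le_of_mul_le_mul_left h5 (by linarith)
    refine ⟨?_, by linarith⟩
    have h7 : d * (t - r) ≤ n * t := by
      have : 0 ≤ (n - d) * t := mul_nonneg (by linarith) ht
      have : 0 ≤ d * r := mul_nonneg (by nlinarith) hr
      linarith
    have h8 : n * (r * t) ≤ n * (t * t) := by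
      have := mul_le_mul_of_nonneg_right h ht
      exact mul_le_mul_of_nonneg_left this (by linarith)
    have h9 : n * (0.01 * d) ≤ n * (t * t + t) := by nlinarith [sq_nonneg q]
    have h10 : 0.01 * d ≤ t * t + t := le_of_mul_le_mul_left h9 (by linarith)
    by_contra! hcon
    nlinarith

/-- The case of many more triangles than in a random graph; here `x` is the normalised triangle
excess. -/
theorem eigenvalue_bounds_of_lt (hr : 0 ≤ r) (ht : 0 ≤ t) (hq : 1 ≤ q) (hd : d = q ^ 2)
    (hdn : d ≤ 0.99 * n) (hrt : r * t ≤ d)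
    (htr : (n - 1) * (r * t) = d * (n - d) + d * (r - t))
    (hx : x = (n - d) * (r - t) - r * t) (h : 6 * n * q < x) :
    n ^ 2 * d / 100000 ≤ n * t * x ∧ n * t * x ≤ n ^ 2 * d := by
  have hn : 1 ≤ n := by nlinarith
  have hrt0 : 0 ≤ r * t := by positivity
  have hd0 : 0 ≤ d := by nlinarith
  have h0 : 0 < r - t := by
    by_contra! hcon
    nlinarith
  have h1 : x ≤ n * r := by nlinarith [mul_nonneg hd0 h0.le]
  have h2 : 6 * q < r := by
    by_contra! hcon
    nlinarith
  have h3 : t ≤ r / 36 := by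
    by_contra! hcon
    have : 6 * q * (6 * q) ≤ r * r := mul_self_le_mul_self (by linarith) h2.le
    nlinarith
  have h4 : 0 ≤ (n - d - 0.01 * n) * (r - t) := mul_nonneg (by linarith) h0.le
  have h5 : 0 ≤ n * (r / 36 - t) := mul_nonneg (by linarith) (by linarith)
  have h6 : n ≤ n * q := by nlinarith
  have h7 : 0.008 * (n * r) ≤ x := by nlinarith
  have h8 : n * (0.01 * d) ≤ n * (r * t) := by
    nlinarith [mul_nonneg hd0 h0.le, mul_nonneg hd0 (by linarith : (0 : ℝ) ≤ 0.99 * n - d)]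
  have hnt : 0 ≤ n * t := by positivity
  have h9 := mul_le_mul_of_nonneg_left h7 hnt
  have h10 := mul_le_mul_of_nonneg_left h1 hnt
  have h11 := mul_le_mul_of_nonneg_left h8 (by linarith : 0 ≤ n)
  have h12 := mul_le_mul_of_nonneg_left hrt (by positivity : 0 ≤ n * n)
  have h13 : 0 ≤ n * n * d := by positivity
  constructor <;> nlinarith

end Parameters

theorem surplus_eq_zero_of_isRegularOfDegree_zero [Fintype V] [DecidableEq V] {G : SimpleGraph V}
    [DecidableRel G.Adj] (hG : G.IsRegularOfDegree 0) : surplus G = 0 := by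
  have hA : G.adjMatrix ℝ = 0 := by
    ext u v
    have : ¬ G.Adj u v := fun h => ((G.degree_pos_iff_exists_adj u).2 ⟨v, h⟩).ne' (hG u)
    simp [this]
  refine le_antisymm ?_ ?_
  · simpa using surplus_le_of_forall_sign G 0 hG 0 fun z _ => by simp [hA]
  · simpa [hA] using neg_dotProduct_le_surplus G 0 hG 1 fun v => by simp

theorem _root_.SimpleGraph.IsSRGWith.exists_nonadj_param_le [Fintype V] [DecidableEq V]
    {G : SimpleGraph V} [DecidableRel G.Adj] {n d η μ : ℕ} (hG : G.IsSRGWith n d η μ) :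
    ∃ μ' ≤ d, G.IsSRGWith n d η μ' := by
  by_cases h : ∃ u v, u ≠ v ∧ ¬ G.Adj u v
  · obtain ⟨u, v, huv, ha⟩ := h
    refine ⟨μ, ?_, hG⟩
    rw [← hG.of_not_adj huv ha, ← hG.regular u]
    exact G.card_commonNeighbors_le_degree_left u v
  · push Not at h
    exact ⟨0, d.zero_le, hG.card, hG.regular, hG.of_adj, fun u v huv ha => (ha (h u v huv)).elim⟩

theorem _root_.SimpleGraph.IsSRGWith.adj_param_lt [Fintype V] [DecidableEq V]
    {G : SimpleGraph V} [DecidableRel G.Adj] {n d η μ : ℕ} (hG : G.IsSRGWith n d η μ)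
    (hd : 1 ≤ d) (hn : 0 < n) : η < d := by
  obtain ⟨u⟩ := Fintype.card_pos_iff.1 (hG.card ▸ hn)
  obtain ⟨v, hv⟩ := (G.degree_pos_iff_exists_adj u).1 (by rw [hG.regular u]; exact hd)
  rw [← hG.of_adj u v hv, ← hG.regular u]
  exact hv.card_commonNeighbors_lt_degree

/-- Tight (two-sided) bounds on the surplus of a strongly regular graph with `n`
vertices, degree `d ≤ 0.99n` and `d³/6 + s` triangles. -/
theorem statement7 :
    ∃ c C : ℝ, 0 < c ∧ 0 < C ∧
      ∀ (V : Type) [Fintype V] (G : SimpleGraph V) (d η μ : ℕ) (s : ℝ),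
        (∀ v : V, degC G v = d) →
        (∀ u v : V, G.Adj u v → Nat.card (G.commonNeighbors u v) = η) →
        (∀ u v : V, u ≠ v → ¬ G.Adj u v → Nat.card (G.commonNeighbors u v) = μ) →
        (d : ℝ) ≤ 0.99 * (Fintype.card V : ℝ) →
        (cliqueCount G 3 : ℝ) = (d : ℝ) ^ 3 / 6 + s →
        ((s < -(Fintype.card V : ℝ) * (d : ℝ) ^ ((3 : ℝ) / 2) →
            c * |s| / d ≤ surplus G ∧ surplus G ≤ C * |s| / d) ∧
         (-(Fintype.card V : ℝ) * (d : ℝ) ^ ((3 : ℝ) / 2) ≤ s ∧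
            s ≤ (Fintype.card V : ℝ) * (d : ℝ) ^ ((3 : ℝ) / 2) →
            c * (Fintype.card V : ℝ) * (d : ℝ) ^ ((1 : ℝ) / 2) ≤ surplus G ∧
              surplus G ≤ C * (Fintype.card V : ℝ) * (d : ℝ) ^ ((1 : ℝ) / 2)) ∧
         ((Fintype.card V : ℝ) * (d : ℝ) ^ ((3 : ℝ) / 2) < s →
            c * (Fintype.card V : ℝ) ^ 2 * (d : ℝ) ^ 2 / s ≤ surplus G ∧
              surplus G ≤ C * (Fintype.card V : ℝ) ^ 2 * (d : ℝ) ^ 2 / s)) := by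
  classical
  have hk : 0 < Real.exp (-1) / 4 := by positivity
  refine ⟨Real.exp (-1) / 4 / 1000000, 1000, by positivity, by norm_num, ?_⟩
  intro V _ G d η μ s hdeg hη hμ hdn hs
  have hreg : G.IsRegularOfDegree d := fun v => by
    rw [← hdeg v, degC, Nat.card_eq_fintype_card, SimpleGraph.card_neighborSet_eq_degree]
  have hsrg : G.IsSRGWith (Fintype.card V) d η μ :=
    ⟨rfl, hreg, fun u v h => by rw [← hη u v h, Nat.card_eq_fintype_card],
      fun u v huv h => by rw [← hμ u v huv h, Nat.card_eq_fintype_card]⟩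
  have htri : 6 * (cliqueCount G 3 : ℝ) = Fintype.card V * d * η := by
    exact_mod_cast six_mul_cliqueCount_three G d η hreg hsrg.of_adj
  rcases Nat.eq_zero_or_pos d with rfl | hd
  · have hs0 : s = 0 := by
      simp only [Nat.cast_zero] at hs htri
      linarith
    have hsp := surplus_eq_zero_of_isRegularOfDegree_zero hreg
    have h1 : (0 : ℝ) ^ ((3 : ℝ) / 2) = 0 := Real.zero_rpow (by norm_num)
    have h2 : (0 : ℝ) ^ ((1 : ℝ) / 2) = 0 := Real.zero_rpow (by norm_num)
    simp only [Nat.cast_zero, h1, h2, hs0, hsp]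
    simp
  have hd1 : (1 : ℝ) ≤ d := by exact_mod_cast hd
  have hn : 0 < Fintype.card V := by
    rw [← Nat.cast_pos (α := ℝ)]
    linarith
  obtain ⟨μ, hμd, hsrg⟩ := hsrg.exists_nonadj_param_le
  obtain ⟨r, t, hsub, h⟩ := exists_eigenData hsrg hd hn (hsrg.adj_param_lt hd hn) hμd
  obtain ⟨hlow, hupp⟩ := h.surplus_bounds hreg hn
  generalize surplus G = S at *
  have hrt := h.mul_eq
  have hcard := h.mul_card
  have hr := h.r_nonneg
  have ht := h.t_nonneg
  have hm := h.m_nonneg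
  generalize (μ : ℝ) = m at *
  have hn' : (1 : ℝ) ≤ Fintype.card V := by exact_mod_cast hn
  generalize (Fintype.card V : ℝ) = n at *
  generalize (d : ℝ) = D at *
  have hD0 : 0 < D := by linarith
  set q := Real.sqrt D with hq
  have hqD : D = q ^ 2 := (Real.sq_sqrt hD0.le).symm
  have hq1 : 1 ≤ q := by rw [hq]; exact Real.one_le_sqrt.2 hd1
  have hpow1 : D ^ ((1 : ℝ) / 2) = q := (Real.sqrt_eq_rpow D).symm
  have hpow3 : D ^ ((3 : ℝ) / 2) = D * q := by
    rw [← hpow1, ← Real.rpow_one_add' hD0.le (by norm_num)]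
    norm_num
  rw [hpow1, hpow3]
  have hrtD : r * t ≤ D := by linarith
  have htr : (n - 1) * (r * t) = D * (n - D) + D * (r - t) := by
    linear_combination n * hrt + hcard
  let x := (n - D) * (r - t) - r * t
  have hsx : 6 * s = D * x := by
    have : 6 * s = n * D * η - D ^ 3 := by linarith
    rw [this]
    simp only [x]
    linear_combination -D * hcard - n * D * hsub
  have hsx' : s = D * (x / 6) := by linarith
  have hsd : s / D = x / 6 := by rw [hsx']; field_simp
  refine ⟨fun hlt => ?_, fun ⟨h1, h2⟩ => ?_, fun hlt => ?_⟩
  · have hx : D * x < D * (-(6 * n * q)) := by linarith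
    have hx' : x < -(6 * n * q) := lt_of_mul_lt_mul_left hx hD0.le
    have hs0 : s < 0 := hlt.trans_le (by
      have : 0 ≤ n * (D * q) := by positivity
      linarith)
    obtain ⟨h1, h2⟩ := eigenvalue_bounds_of_lt_neg (x := -x) hr ht hq1 hqD hdn hrtD
      (by simp only [x]; ring) (by linarith)
    rw [mul_div_assoc, mul_div_assoc, abs_of_neg hs0, neg_div, hsd]
    constructor
    · refine le_trans ?_ hlow
      rw [div_mul_eq_mul_div, mul_div_assoc]
      exact mul_le_mul_of_nonneg_left (by nlinarith) hk.le
    · have : 0 ≤ n * q := by positivity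
      linarith
  · have hx1 : D * x ≤ D * (6 * n * q) := by linarith
    have hx2 : D * (-(6 * n * q)) ≤ D * x := by linarith
    have hx1 := le_of_mul_le_mul_left hx1 hD0
    have hx2 := le_of_mul_le_mul_left hx2 hD0
    obtain ⟨h1, h2⟩ := eigenvalue_bounds_of_abs_le (x := -x) hr ht hq1 hqD hdn hrtD htr
      (by simp only [x]; ring) (by linarith) (by linarith)
    constructor
    · refine le_trans ?_ hlow
      have h3 := mul_le_mul_of_nonneg_left h1 hk.le
      have h4 : 0 ≤ Real.exp (-1) / 4 * (n * q) := by positivity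
      linarith
    · linarith
  · have hx : D * (6 * n * q) < D * x := by linarith
    have hx := lt_of_mul_lt_mul_left hx hD0.le
    obtain ⟨h1, h2⟩ := eigenvalue_bounds_of_lt hr ht hq1 hqD hdn hrtD htr rfl hx
    have hx0 : 0 < x := lt_trans (by positivity) hx
    have hfrac (c : ℝ) : c * n ^ 2 * D ^ 2 / s = 6 * c * (n ^ 2 * D / x) := by
      rw [hsx']; field_simp
    have h3 : n ^ 2 * D / x ≤ 100000 * (n * t) := by
      rw [div_le_iff₀ hx0]
      linarith
    have h4 : n * t ≤ n ^ 2 * D / x := (le_div_iff₀ hx0).2 h2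
    rw [hfrac, hfrac]
    have hnt : 0 ≤ n * t := by positivity
    constructor
    · refine le_trans ?_ hlow
      have h5 := mul_le_mul_of_nonneg_left h3 hk.le
      have h6 : 0 ≤ Real.exp (-1) / 4 * (n * t) := by positivity
      linarith
    · linarith

end MaxCutPaper
end

section
/- Let α and β be real numbers with β > 0, α < β and α + β ≤ 2. Then there exist positive constants c₁, c₂ and C (depending only on α, β) such that the following holds. Let G be a finite simple graph on n ≥ 1 vertices with average degree d = 2e(G)/n > 0. Then either G has surplus at least c₁·n^α·d^β, or G has an induced subgraph G̃ with ñ vertices and average degree d̃ such that ñ^α·d̃^β ≥ c₂·n^α·d^β, the minimum degree of G̃ is at least d̃/C, and the maximum degree of G̃ is at most C·d̃. -/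
namespace MaxCutPaper

variable {V : Type*}

section Helpers

open Finset

open scoped Classical in
/-- The number of ordered pairs `(u, v)` of adjacent vertices with `u ∈ S` and `v ∈ T`. -/
noncomputable def adjPairs (G : SimpleGraph V) (S T : Finset V) : ℝ :=
  ∑ u ∈ S, ∑ v ∈ T, if G.Adj u v then 1 else 0

section AdjPairs

variable (G : SimpleGraph V)

lemma adjPairs_comm (S T : Finset V) : adjPairs G S T = adjPairs G T S := by
  classical
  unfold adjPairs
  rw [Finset.sum_comm]
  simp only [G.adj_comm]

lemma adjPairs_nonneg (S T : Finset V) : 0 ≤ adjPairs G S T := by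
  unfold adjPairs
  exact Finset.sum_nonneg fun _ _ => Finset.sum_nonneg fun _ _ => by split_ifs <;> norm_num

lemma adjPairs_le (S T : Finset V) : adjPairs G S T ≤ (#S : ℝ) * #T := by
  unfold adjPairs
  calc _ ≤ ∑ u ∈ S, ∑ v ∈ T, (1 : ℝ) :=
        Finset.sum_le_sum fun _ _ => Finset.sum_le_sum fun _ _ => by split_ifs <;> norm_num
    _ = _ := by simp

lemma adjPairs_mono_right (S : Finset V) {T T' : Finset V} (h : T ⊆ T') :
    adjPairs G S T ≤ adjPairs G S T' := by
  unfold adjPairs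
  exact Finset.sum_le_sum fun _ _ => Finset.sum_le_sum_of_subset_of_nonneg h
    fun _ _ _ => by split_ifs <;> norm_num

lemma adjPairs_eq_sum (S T : Finset V) :
    adjPairs G S T = ∑ u ∈ S, adjPairs G {u} T := by
  simp [adjPairs]

lemma adjPairs_union_right [DecidableEq V] (S : Finset V) {T T' : Finset V}
    (h : Disjoint T T') : adjPairs G S (T ∪ T') = adjPairs G S T + adjPairs G S T' := by
  unfold adjPairs
  rw [← Finset.sum_add_distrib]
  exact Finset.sum_congr rfl fun _ _ => Finset.sum_union h

lemma adjPairs_union_self [DecidableEq V] {S T : Finset V} (h : Disjoint S T) :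
    adjPairs G (S ∪ T) (S ∪ T) =
      adjPairs G S S + 2 * adjPairs G S T + adjPairs G T T := by
  rw [adjPairs_union_right G _ h, adjPairs_comm G _ S, adjPairs_comm G _ T,
    adjPairs_union_right G _ h, adjPairs_union_right G _ h, adjPairs_comm G T S]
  ring

lemma adjPairs_singleton_self (v : V) : adjPairs G {v} {v} = 0 := by
  simp [adjPairs]

lemma adjPairs_eq_natCast (S T : Finset V) : ∃ k : ℕ, adjPairs G S T = k := by
  classical
  exact ⟨∑ u ∈ S, ∑ v ∈ T, if G.Adj u v then 1 else 0, by simp [adjPairs]⟩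

lemma card_neighbors_eq_adjPairs (S : Finset V) (v : V) :
    (Nat.card {u : V // u ∈ S ∧ G.Adj v u} : ℝ) = adjPairs G {v} S := by
  classical
  have : Nat.card {u : V // u ∈ S ∧ G.Adj v u} = #(S.filter fun u => G.Adj v u) := by
    rw [← Nat.card_eq_finsetCard]
    exact Nat.card_congr (Equiv.subtypeEquivRight fun u => by simp)
  rw [this]
  simp [adjPairs]

lemma two_mul_edgeCount_eq_adjPairs_univ [Fintype V] :
    2 * (edgeCount G : ℝ) = adjPairs G univ univ := by
  classical
  have h := G.sum_degrees_eq_twice_card_edges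
  have h' : edgeCount G = #G.edgeFinset := by
    rw [edgeCount, Nat.card_eq_fintype_card, SimpleGraph.edgeFinset_card]
  rw [h']
  have h2 : (2 * #G.edgeFinset : ℝ) = ∑ v, (G.degree v : ℝ) := by exact_mod_cast h.symm
  rw [h2, adjPairs]
  refine Finset.sum_congr rfl fun v _ => ?_
  rw [Finset.sum_boole, ← G.card_neighborFinset_eq_degree, G.neighborFinset_eq_filter]

lemma two_mul_edgeCount_induce_eq_adjPairs (A : Finset V) :
    2 * (edgeCount (G.induce (↑A : Set V)) : ℝ) = adjPairs G A A := by
  classical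
  rw [two_mul_edgeCount_eq_adjPairs_univ]
  unfold adjPairs
  rw [← Finset.sum_coe_sort A]
  refine Finset.sum_congr rfl fun u _ => ?_
  rw [← Finset.sum_coe_sort A]
  rfl

end AdjPairs

section Surplus

variable [Fintype V] (G : SimpleGraph V)

open scoped Classical in
/-- The quadratic form of the adjacency matrix. -/
noncomputable def adjForm (x : V → ℝ) : ℝ :=
  ∑ u, ∑ v, (if G.Adj u v then 1 else 0) * (x u * x v)

lemma adjForm_update_le [DecidableEq V] (x : V → ℝ) (v : V) (hx : |x v| ≤ 1) :
    ∃ s : ℝ, (s = 1 ∨ s = -1) ∧ adjForm G (Function.update x v s) ≤ adjForm G x := by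
  classical
  obtain ⟨a, b, hab⟩ : ∃ a b : ℝ, ∀ s, adjForm G (Function.update x v s) = a + s * b := by
    refine ⟨∑ u ∈ univ.erase v, ∑ w ∈ univ.erase v, (if G.Adj u w then 1 else 0) * (x u * x w),
      2 * ∑ w ∈ univ.erase v, (if G.Adj v w then 1 else 0) * x w, fun s => ?_⟩
    unfold adjForm
    have key : ∀ u, ∑ w, (if G.Adj u w then (1 : ℝ) else 0) *
        (Function.update x v s u * Function.update x v s w) =
        (if G.Adj u v then 1 else 0) * (Function.update x v s u * s) +
        ∑ w ∈ univ.erase v, (if G.Adj u w then 1 else 0) * (Function.update x v s u * x w) := by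
      intro u
      rw [← Finset.add_sum_erase _ _ (mem_univ v)]
      congr 1
      · simp
      · refine Finset.sum_congr rfl fun w hw => ?_
        rw [Function.update_of_ne (Finset.ne_of_mem_erase hw) s x]
    simp only [key]
    rw [← Finset.add_sum_erase _ _ (mem_univ v)]
    have h2 : ∀ u ∈ univ.erase v, (if G.Adj u v then (1 : ℝ) else 0) *
        (Function.update x v s u * s) + ∑ w ∈ univ.erase v, (if G.Adj u w then 1 else 0) *
          (Function.update x v s u * x w) = s * ((if G.Adj v u then 1 else 0) * x u) +
          ∑ w ∈ univ.erase v, (if G.Adj u w then 1 else 0) * (x u * x w) := by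
      intro u hu
      rw [Function.update_of_ne (Finset.ne_of_mem_erase hu) s x]
      simp only [G.adj_comm u v]
      ring
    rw [Finset.sum_congr rfl h2, Finset.sum_add_distrib, ← Finset.mul_sum]
    simp only [SimpleGraph.irrefl, if_false, zero_mul, zero_add, Function.update_self]
    have h3 : ∑ w ∈ univ.erase v, (if G.Adj v w then (1 : ℝ) else 0) * (s * x w) =
        s * ∑ w ∈ univ.erase v, (if G.Adj v w then 1 else 0) * x w := by
      rw [Finset.mul_sum]
      exact Finset.sum_congr rfl fun w _ => by ring
    rw [h3]
    ring
  have hx0 := hab (x v)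
  rw [Function.update_eq_self] at hx0
  obtain ⟨h1, h2⟩ := abs_le.1 hx
  rcases le_total 0 b with hb | hb
  · exact ⟨-1, Or.inr rfl, by rw [hab, hx0]; nlinarith⟩
  · exact ⟨1, Or.inl rfl, by rw [hab, hx0]; nlinarith⟩

lemma exists_sign_adjForm_le (x : V → ℝ) (hx : ∀ v, |x v| ≤ 1) :
    ∃ y : V → ℝ, (∀ v, y v = 1 ∨ y v = -1) ∧ adjForm G y ≤ adjForm G x := by
  classical
  suffices H : ∀ T : Finset V, ∃ y : V → ℝ, (∀ v, |y v| ≤ 1) ∧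
      (∀ v ∈ T, y v = 1 ∨ y v = -1) ∧ adjForm G y ≤ adjForm G x by
    obtain ⟨y, -, h, hy⟩ := H univ
    exact ⟨y, fun v => h v (mem_univ v), hy⟩
  intro T
  induction T using Finset.induction_on with
  | empty => exact ⟨x, hx, by simp, le_rfl⟩
  | insert v T _ ih =>
    obtain ⟨y, hy1, hyT, hy⟩ := ih
    obtain ⟨s, hs, hle⟩ := adjForm_update_le G y v (hy1 v)
    refine ⟨Function.update y v s, fun u => ?_, fun u hu => ?_, hle.trans hy⟩
    · by_cases huv : u = v
      · subst huv
        rcases hs with rfl | rfl <;> simp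
      · simpa [huv] using hy1 u
    · by_cases huv : u = v
      · subst huv
        simpa using hs
      · simpa [huv] using hyT u ((Finset.mem_insert.1 hu).resolve_left huv)

lemma cutSize_eq_adjPairs [DecidableEq V] (S : Finset V) :
    (cutSize G S : ℝ) = adjPairs G S Sᶜ := by
  classical
  have : cutSize G S = #((S ×ˢ Sᶜ).filter fun p => G.Adj p.1 p.2) := by
    rw [cutSize, Nat.card_eq_fintype_card, Fintype.card_subtype]
    congr 1
    ext p
    simp [and_assoc]
  rw [this, Finset.card_filter, adjPairs, ← Finset.sum_product']
  push_cast
  rfl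

/-- A fractional sign assignment with values in `[-1, 1]` gives a lower bound on the surplus. -/
lemma neg_adjForm_div_four_le_surplus (x : V → ℝ) (hx : ∀ v, |x v| ≤ 1) :
    -adjForm G x / 4 ≤ surplus G := by
  classical
  obtain ⟨y, hy, hle⟩ := exists_sign_adjForm_le G x hx
  set S : Finset V := univ.filter fun v => y v = 1 with hS
  have hcut : (cutSize G S : ℝ) ≤ maxCut G := by
    exact_mod_cast Finset.le_sup (f := cutSize G) (Finset.mem_powerset.2 (Finset.subset_univ S))
  have hform : adjForm G y = adjPairs G univ univ - 4 * adjPairs G S Sᶜ := by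
    have h1 : adjPairs G univ univ =
        adjPairs G S S + 2 * adjPairs G S Sᶜ + adjPairs G Sᶜ Sᶜ := by
      rw [← adjPairs_union_self G disjoint_compl_right, Finset.union_compl]
    have h2 : adjForm G y = adjPairs G S S - adjPairs G S Sᶜ - adjPairs G Sᶜ S
        + adjPairs G Sᶜ Sᶜ := by
      have hin : ∀ u ∈ S, y u = 1 := fun u hu => (Finset.mem_filter.1 hu).2
      have hout : ∀ u ∈ Sᶜ, y u = -1 := fun u hu => by
        rw [hS, Finset.mem_compl, Finset.mem_filter] at hu
        exact (hy u).resolve_left fun h => hu ⟨mem_univ u, h⟩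
      have hrow : ∀ u, ∑ v, (if G.Adj u v then (1 : ℝ) else 0) * (y u * y v) =
          y u * (adjPairs G {u} S - adjPairs G {u} Sᶜ) := by
        intro u
        rw [← Finset.sum_add_sum_compl S, mul_sub, adjPairs, adjPairs, Finset.sum_singleton,
          Finset.sum_singleton, Finset.mul_sum, Finset.mul_sum, sub_eq_add_neg,
          ← Finset.sum_neg_distrib]
        congr 1
        · exact Finset.sum_congr rfl fun v hv => by rw [hin v hv]; ring
        · exact Finset.sum_congr rfl fun v hv => by rw [hout v hv]; ring
      unfold adjForm
      simp only [hrow]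
      have hS1 : ∑ u ∈ S, y u * (adjPairs G {u} S - adjPairs G {u} Sᶜ) =
          adjPairs G S S - adjPairs G S Sᶜ := by
        rw [adjPairs_eq_sum G S S, adjPairs_eq_sum G S Sᶜ, ← Finset.sum_sub_distrib]
        exact Finset.sum_congr rfl fun u hu => by rw [hin u hu, one_mul]
      have hS2 : ∑ u ∈ Sᶜ, y u * (adjPairs G {u} S - adjPairs G {u} Sᶜ) =
          adjPairs G Sᶜ Sᶜ - adjPairs G Sᶜ S := by
        rw [adjPairs_eq_sum G Sᶜ S, adjPairs_eq_sum G Sᶜ Sᶜ, ← Finset.sum_sub_distrib]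
        exact Finset.sum_congr rfl fun u hu => by rw [hout u hu]; ring
      rw [← Finset.sum_add_sum_compl S, hS1, hS2]
      ring
    rw [h2, h1, adjPairs_comm G Sᶜ S]
    ring
  have he := two_mul_edgeCount_eq_adjPairs_univ G
  rw [cutSize_eq_adjPairs] at hcut
  unfold surplus
  linarith

/-- Placing all of `B` on one side and a `t`-biased random part of `U` on the other. -/
lemma le_surplus_of_disjoint {B U : Finset V} (hBU : Disjoint B U) {t : ℝ} (ht0 : 0 ≤ t)
    (ht1 : t ≤ 1) :
    (2 * t * adjPairs G B U - adjPairs G B B - t ^ 2 * adjPairs G U U) / 4 ≤ surplus G := by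
  classical
  set x : V → ℝ := fun v => (if v ∈ B then 1 else 0) - t * (if v ∈ U then 1 else 0) with hx
  have hbound : ∀ v, |x v| ≤ 1 := by
    intro v
    have hv : v ∈ B → v ∉ U := fun h => Finset.disjoint_left.1 hBU h
    rw [abs_le]
    by_cases h1 : v ∈ B <;> by_cases h2 : v ∈ U <;> (simp_all; try linarith)
  have hpair : ∀ S T : Finset V, adjPairs G S T = ∑ u, ∑ v, (if G.Adj u v then (1 : ℝ) else 0) *
      ((if u ∈ S then 1 else 0) * (if v ∈ T then 1 else 0)) := by
    intro S T
    unfold adjPairs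
    rw [← Finset.sum_subset (Finset.subset_univ S) fun u _ hu => by simp [hu]]
    refine Finset.sum_congr rfl fun u hu => ?_
    rw [← Finset.sum_subset (Finset.subset_univ T) fun v _ hv => by simp [hv]]
    exact Finset.sum_congr rfl fun v hv => by simp [hu, hv]
  have hform : adjForm G x = adjPairs G B B - t * adjPairs G B U - t * adjPairs G U B +
      t ^ 2 * adjPairs G U U := by
    rw [hpair, hpair, hpair, hpair]
    simp only [Finset.mul_sum, ← Finset.sum_sub_distrib, ← Finset.sum_add_distrib]
    unfold adjForm
    exact Finset.sum_congr rfl fun u _ => Finset.sum_congr rfl fun v _ => by simp only [hx]; ring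
  have := neg_adjForm_div_four_le_surplus G x hbound
  rw [hform, adjPairs_comm G U B] at this
  linarith

end Surplus

section Regularization

variable (G : SimpleGraph V)

/-- Deleting low-degree vertices: every `U` contains a subset `A` of minimum degree at least
`δ / 2` that loses at most `δ * #U` ordered adjacent pairs. -/
lemma exists_subset_le_degree (U : Finset V) {δ : ℝ} (hδ : 0 ≤ δ) :
    ∃ A ⊆ U, adjPairs G U U - δ * #U ≤ adjPairs G A A ∧
      ∀ v ∈ A, δ / 2 ≤ adjPairs G {v} A := by
  classical
  obtain ⟨A, hA, hmax⟩ := U.powerset.exists_max_image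
    (fun S => adjPairs G S S - δ * (#S : ℝ)) ⟨U, Finset.mem_powerset_self U⟩
  rw [Finset.mem_powerset] at hA
  refine ⟨A, hA, ?_, fun v hv => ?_⟩
  · have h1 := hmax U (Finset.mem_powerset_self U)
    have h2 : 0 ≤ δ * (#A : ℝ) := by positivity
    linarith
  · have h1 := hmax (A.erase v) (Finset.mem_powerset.2 ((Finset.erase_subset v A).trans hA))
    have hd : Disjoint {v} (A.erase v) := by simp
    have hu : {v} ∪ A.erase v = A := by rw [← Finset.insert_eq, Finset.insert_erase hv]
    have h2 := adjPairs_union_self G hd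
    have h3 := adjPairs_union_right G {v} hd
    rw [hu, adjPairs_singleton_self] at h2 h3
    have h4 : (#A : ℝ) = #(A.erase v) + 1 := by
      exact_mod_cast (Finset.card_erase_add_one hv).symm
    simp only [h4] at h1
    linarith

lemma rpow_mul_rpow_le_right {α β N M : ℝ} (hαβ : α < β) (hsum : α + β ≤ 2) (hN : 1 ≤ N)
    (hM : 1 ≤ M) (hMN : M ≤ N * N) : N ^ (α - β) * M ^ β ≤ M := by
  have hN0 : 0 < N := by linarith
  have hM0 : 0 < M := by linarith
  have hMβ : M ^ β = M * M ^ (β - 1) := by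
    rw [Real.rpow_sub_one hM0.ne']
    field_simp
  suffices h : N ^ (α - β) * M ^ (β - 1) ≤ 1 by
    rw [hMβ]
    nlinarith
  rcases le_total 1 β with hβ | hβ
  · calc N ^ (α - β) * M ^ (β - 1) ≤ N ^ (α - β) * (N * N) ^ (β - 1) := by
          gcongr
      _ = N ^ (α + β - 2) := by
          rw [Real.mul_rpow hN0.le hN0.le, ← Real.rpow_add hN0, ← Real.rpow_add hN0]
          ring_nf
      _ ≤ 1 := Real.rpow_le_one_of_one_le_of_nonpos hN (by linarith)
  · exact mul_le_one₀ (Real.rpow_le_one_of_one_le_of_nonpos hN (by linarith)) (by positivity)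
      (Real.rpow_le_one_of_one_le_of_nonpos hM (by linarith))

lemma rpow_mul_div_rpow {α β N M : ℝ} (hN : 0 < N) (hM : 0 ≤ M) :
    N ^ α * (M / N) ^ β = N ^ (α - β) * M ^ β := by
  rw [Real.div_rpow hM hN.le, Real.rpow_sub hN]
  ring

/-- If no subset of `H` beats `H` in `#S ^ (α - β) * adjPairs G S S ^ β`, then the surplus of `G`
is large or `H` contains an almost regular induced subgraph. -/
lemma le_surplus_or_exists_regular [Fintype V] {α β K : ℝ} (hβ : 0 < β) (hαβ : α < β)
    (hK : 0 < K) (hKβ : (128 : ℝ) ^ β < K ^ (β - α)) (H : Finset V) (hH : 0 < adjPairs G H H)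
    (hmax : ∀ S ⊆ H, (#S : ℝ) ^ (α - β) * adjPairs G S S ^ β ≤
      (#H : ℝ) ^ (α - β) * adjPairs G H H ^ β) :
    adjPairs G H H / 512 ≤ surplus G ∨ ∃ A ⊆ H, A.Nonempty ∧
      adjPairs G H H / 4 ≤ adjPairs G A A ∧
      (∀ v ∈ A, adjPairs G A A / #A / (8 * K) ≤ adjPairs G {v} A) ∧
      (∀ v ∈ A, adjPairs G {v} A ≤ 8 * K * (adjPairs G A A / #A)) := by
  classical
  have pos_card : ∀ S : Finset V, 0 < adjPairs G S S → 0 < (#S : ℝ) := by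
    intro S hS
    rw [Nat.cast_pos, Finset.card_pos]
    by_contra h
    rw [Finset.not_nonempty_iff_eq_empty] at h
    simp [h, adjPairs] at hS
  set M := adjPairs G H H with hM
  have hN := pos_card H hH
  set D : ℝ := M / #H with hD
  have hDpos : 0 < D := by positivity
  have hDN : D * #H = M := by rw [hD]; field_simp
  clear_value D
  set B := H.filter fun v => K * D < adjPairs G {v} H with hB
  set U := H.filter fun v => ¬ K * D < adjPairs G {v} H with hU
  have hBU : Disjoint B U := Finset.disjoint_filter_filter_not _ _ _
  have hHBU : B ∪ U = H := Finset.filter_union_filter_not_eq _ _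
  have hBH : B ⊆ H := Finset.filter_subset _ _
  have hUH : U ⊆ H := Finset.filter_subset _ _
  have hsplit := adjPairs_union_self G hBU
  rw [hHBU, ← hM] at hsplit
  have hBcard : (#B : ℝ) * K ≤ #H := by
    have h1 : (#B : ℝ) * (K * D) ≤ M := by
      calc (#B : ℝ) * (K * D) = ∑ v ∈ B, K * D := by simp
        _ ≤ ∑ v ∈ B, adjPairs G {v} H :=
            Finset.sum_le_sum fun v hv => (Finset.mem_filter.1 hv).2.le
        _ = adjPairs G H B := by rw [← adjPairs_eq_sum, adjPairs_comm]
        _ ≤ M := adjPairs_mono_right G H hBH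
    rw [← hDN] at h1
    nlinarith
  have hBsmall : adjPairs G B B < M / 128 := by
    by_contra! h
    have hBpos : 0 < adjPairs G B B := by linarith
    have hBc := pos_card B hBpos
    have h1 := hmax B hBH
    have h2 : ((#H : ℝ) / K) ^ (α - β) ≤ (#B : ℝ) ^ (α - β) :=
      Real.rpow_le_rpow_of_nonpos hBc (by rwa [le_div_iff₀ hK]) (by linarith)
    have h3 : (M / 128) ^ β ≤ adjPairs G B B ^ β := by gcongr
    have h4 : ((#H : ℝ) / K) ^ (α - β) * (M / 128) ^ β ≤ (#H : ℝ) ^ (α - β) * M ^ β :=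
      (mul_le_mul h2 h3 (by positivity) (Real.rpow_nonneg hBc.le _)).trans h1
    rw [Real.div_rpow hN.le hK.le, Real.div_rpow hH.le (by norm_num),
      ← neg_sub β α, Real.rpow_neg hK.le (β - α), div_inv_eq_mul] at h4
    have h5 : 0 < (#H : ℝ) ^ (-(β - α)) * M ^ β :=
      mul_pos (Real.rpow_pos_of_pos hN _) (Real.rpow_pos_of_pos hH _)
    have h6 : (#H : ℝ) ^ (-(β - α)) * K ^ (β - α) * (M ^ β / 128 ^ β) =
        ((#H : ℝ) ^ (-(β - α)) * M ^ β) * (K ^ (β - α) / 128 ^ β) := by ring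
    have h7 : 1 < K ^ (β - α) / (128 : ℝ) ^ β := by
      rwa [one_lt_div (by positivity)]
    rw [h6] at h4
    nlinarith
  by_cases hcut : M / 4 ≤ 2 * adjPairs G B U
  · left
    have h1 := le_surplus_of_disjoint G hBU (t := 1 / 8) (by norm_num) (by norm_num)
    have h2 := adjPairs_nonneg G B B
    linarith
  · right
    push Not at hcut
    obtain ⟨A, hAU, hA1, hA2⟩ := exists_subset_le_degree G U (δ := D / 4) (by positivity)
    have hUcard : D / 4 * (#U : ℝ) ≤ M / 4 := by
      have : (#U : ℝ) ≤ #H := by exact_mod_cast Finset.card_le_card hUH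
      rw [← hDN]
      nlinarith
    have hAM : M / 4 ≤ adjPairs G A A := by linarith
    have hAc := pos_card A (by linarith)
    have hAH := hAU.trans hUH
    have hdeg : ∀ v ∈ A, adjPairs G {v} A ≤ K * D := fun v hv =>
      (adjPairs_mono_right G {v} hAH).trans (not_lt.1 (Finset.mem_filter.1 (hAU hv)).2)
    have hDle : D / 4 ≤ adjPairs G A A / #A := by
      rw [le_div_iff₀ hAc]
      have : (#A : ℝ) ≤ #H := by exact_mod_cast Finset.card_le_card hAH
      nlinarith
    have hleD : adjPairs G A A / #A ≤ K * D := by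
      rw [div_le_iff₀ hAc, adjPairs_eq_sum]
      calc _ ≤ ∑ v ∈ A, K * D := Finset.sum_le_sum hdeg
        _ = _ := by simp [mul_comm]
    refine ⟨A, hAH, Finset.card_pos.1 (by exact_mod_cast hAc), hAM, fun v hv => ?_,
      fun v hv => ?_⟩
    · have h := hA2 v hv
      rw [div_le_iff₀ (by positivity)]
      nlinarith
    · have h := hdeg v hv
      nlinarith

end Regularization

end Helpers

/-- Regularization lemma: either `G` has surplus at least `c₁·n^α·d^β`, or `G` has an
induced subgraph `G̃` with `ñ` vertices, average degree `d̃`, `ñ^α·d̃^β ≥ c₂·n^α·d^β`,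
minimum degree at least `d̃/C` and maximum degree at most `C·d̃`. -/
theorem statement10 (α β : ℝ) (hβ : 0 < β) (hαβ : α < β) (hsum : α + β ≤ 2) :
    ∃ c₁ c₂ C : ℝ, 0 < c₁ ∧ 0 < c₂ ∧ 0 < C ∧
      ∀ (V : Type) [Fintype V] (G : SimpleGraph V) (n d : ℝ),
        n = Fintype.card V → 1 ≤ n → d = 2 * edgeCount G / n → 0 < d →
        (surplus G ≥ c₁ * n ^ α * d ^ β ∨
          ∃ A : Finset V, ∀ dt : ℝ,
            dt = 2 * edgeCount (G.induce (↑A : Set V)) / (A.card : ℝ) →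
            (A.card : ℝ) ^ α * dt ^ β ≥ c₂ * n ^ α * d ^ β ∧
            (∀ v ∈ A, dt / C ≤ (Nat.card {u : V // u ∈ A ∧ G.Adj v u} : ℝ)) ∧
            (∀ v ∈ A, (Nat.card {u : V // u ∈ A ∧ G.Adj v u} : ℝ) ≤ C * dt)) := by
  classical
  set K : ℝ := ((129 : ℝ) ^ β) ^ (β - α)⁻¹ with hK
  have hK0 : 0 < K := by positivity
  have hKβ : (128 : ℝ) ^ β < K ^ (β - α) := by
    rw [hK, Real.rpow_inv_rpow (by positivity) (by linarith)]
    exact Real.rpow_lt_rpow (by norm_num) (by norm_num) hβ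
  refine ⟨1 / 512, (1 / 4) ^ β, 8 * K, by norm_num, by positivity, by positivity, ?_⟩
  intro V _ G n d hn hn1 hd hd0
  have hn0 : 0 < n := by linarith
  rw [two_mul_edgeCount_eq_adjPairs_univ] at hd
  obtain ⟨H, -, hmax⟩ := (Finset.univ : Finset V).powerset.exists_max_image
    (fun S => (S.card : ℝ) ^ (α - β) * adjPairs G S S ^ β) ⟨Finset.univ, by simp⟩
  have hmax' : ∀ S : Finset V, (S.card : ℝ) ^ (α - β) * adjPairs G S S ^ β ≤
      (H.card : ℝ) ^ (α - β) * adjPairs G H H ^ β := fun S => hmax S (by simp)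
  have hfG : n ^ α * d ^ β ≤ (H.card : ℝ) ^ (α - β) * adjPairs G H H ^ β := by
    rw [hd, rpow_mul_div_rpow hn0 (adjPairs_nonneg _ _ _), hn]
    exact hmax' Finset.univ
  have hf0 : 0 < n ^ α * d ^ β := by positivity
  have hH : 0 < adjPairs G H H := by
    refine (adjPairs_nonneg G H H).lt_of_ne' fun h => ?_
    rw [h, Real.zero_rpow hβ.ne', mul_zero] at hfG
    linarith
  have hHN : (1 : ℝ) ≤ H.card := by
    rw [Nat.one_le_cast, Nat.one_le_iff_ne_zero]
    intro h
    rw [Finset.card_eq_zero] at h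
    simp [h, adjPairs] at hH
  rcases le_surplus_or_exists_regular G hβ hαβ hK0 hKβ H hH fun S _ => hmax' S with h | h
  · left
    have hM1 : 1 ≤ adjPairs G H H := by
      obtain ⟨k, hk⟩ := adjPairs_eq_natCast G H H
      rw [hk] at hH ⊢
      exact_mod_cast hH
    have := rpow_mul_rpow_le_right hαβ hsum hHN hM1 (adjPairs_le G H H)
    rw [ge_iff_le, mul_assoc]
    linarith
  · right
    obtain ⟨A, hAH, hne, hAM, hmin, hdeg⟩ := h
    refine ⟨A, fun dt hdt => ?_⟩
    rw [two_mul_edgeCount_induce_eq_adjPairs] at hdt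
    have hAc : (0 : ℝ) < A.card := by exact_mod_cast hne.card_pos
    subst hdt
    refine ⟨?_, fun v hv => ?_, fun v hv => ?_⟩
    · rw [rpow_mul_div_rpow hAc (adjPairs_nonneg _ _ _), ge_iff_le, mul_assoc]
      calc (1 / 4) ^ β * (n ^ α * d ^ β)
          ≤ (1 / 4) ^ β * ((H.card : ℝ) ^ (α - β) * adjPairs G H H ^ β) := by gcongr
        _ = (H.card : ℝ) ^ (α - β) * (adjPairs G H H / 4) ^ β := by
            rw [Real.div_rpow hH.le (by norm_num), Real.div_rpow (by norm_num) (by norm_num),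
              Real.one_rpow]
            ring
        _ ≤ (A.card : ℝ) ^ (α - β) * adjPairs G A A ^ β := by
            refine mul_le_mul ?_ (by gcongr) (by positivity) (by positivity)
            exact Real.rpow_le_rpow_of_nonpos hAc
              (by exact_mod_cast Finset.card_le_card hAH) (by linarith)
    · rw [card_neighbors_eq_adjPairs]
      exact hmin v hv
    · rw [card_neighbors_eq_adjPairs]
      exact hdeg v hv

end MaxCutPaper
end
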